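/- arXiv:2009.12134 — 2 statements merged into one kernel-verified Lean document; each statement's English description precedes it below -/
import Mathlib

section
/- Let b: [0,T]×ℝ^d → ℝ^d be a bounded Borel vector field satisfying the half-Lipschitz condition from below, and let X(x₀,t₀,·) denote the unique backward Filippov flow. Then, for any s,t ∈ [0,T] with s < t, there exists a set E_{s,t} ⊂ ℝ^d of full Lebesgue measure such that for every x ∈ E_{s,t} the preimage X^{-1}({x}, t, s) = {y : X(y,t,s) = x} is a singleton. -/
open MeasureTheory Filter Set
open scoped ENNReal NNReal Topology RealInnerProductSpace

noncomputable section

variable (d : ℕ)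

local notation "V" => EuclideanSpace ℝ (Fin d)

/-- `b` is a bounded Borel vector field on `[0,T] × ℝ^d` satisfying the half-Lipschitz
condition from below with constant `C₀`:
`(b_t(x) - b_t(y))·(x - y) ≥ -C₀|x - y|²`. -/
structure HalfLipschitzField (T : ℝ) (b : ℝ → V → V) (C₀ : ℝ) : Prop where
  pos : 0 < C₀
  meas : Measurable (Function.uncurry b)
  bdd : ∀ t ∈ Icc (0:ℝ) T, ∀ x : V, ‖b t x‖ ≤ C₀
  halfLip : ∀ t ∈ Icc (0:ℝ) T, ∀ x y : V, ⟪b t x - b t y, x - y⟫ ≥ -C₀ * ‖x - y‖ ^ 2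

/-- The Filippov regularization `b^F` of `b`: the (set-valued) essential convex
closure of `b` in the space variable. -/
def filippov (b : ℝ → V → V) (t : ℝ) (x : V) : Set V :=
  ⋂ δ ∈ Ioi (0:ℝ), ⋂ N ∈ {N : Set V | volume N = 0},
    closure (convexHull ℝ (b t '' (Metric.ball x δ \ N)))

/-- `x` is an absolutely continuous solution of the Filippov differential inclusion
`ẋ_s ∈ b^F_s(x_s)` on the interval `[s₀, s₁]`. -/
def IsFilippovSolOn (b : ℝ → V → V) (x : ℝ → V) (s₀ s₁ : ℝ) : Prop :=
  ∃ g : ℝ → V, IntegrableOn g (Ioc s₀ s₁) ∧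
    (∀ᵐ s ∂(volume.restrict (Ioc s₀ s₁)), g s ∈ filippov d b s (x s)) ∧
    ∀ t ∈ Icc s₀ s₁, x t = x s₀ + ∫ s in Ioc s₀ t, g s

/-- `X` is the backward Filippov flow of `b`: for every `x₀` and `t₀ ∈ [0,T]`,
`X x₀ t₀` solves the backward differential inclusion `ẋ_s ∈ b^F_s(x_s)` on `[0, t₀]`
with `X x₀ t₀ t₀ = x₀`. -/
def IsBackwardFilippovFlow (T : ℝ) (b : ℝ → V → V) (X : V → ℝ → ℝ → V) : Prop :=
  ∀ x₀ : V, ∀ t₀ ∈ Icc (0:ℝ) T,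
    IsFilippovSolOn d b (X x₀ t₀) 0 t₀ ∧ X x₀ t₀ t₀ = x₀


theorem aux_topo {E : Type*} [NormedAddCommGroup E] [NormedSpace ℝ E] [FiniteDimensional ℝ E]
    (F : E → E) (hF : Continuous F) (M : ℝ) (hM : ∀ x, ‖F x - x‖ ≤ M)
    (happ : ∀ δ > (0:ℝ), ∃ e : E ≃ₜ E, ∀ x, ‖e x - F x‖ ≤ δ) (x : E) :
    ∃ y, F y = x := by
  have hne : (Metric.closedBall x (M + 1)).Nonempty := by
    refine ⟨x, Metric.mem_closedBall_self ?_⟩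
    have := (norm_nonneg _).trans (hM x)
    linarith
  have : ProperSpace E := FiniteDimensional.proper ℝ E
  obtain ⟨y, hy, hmin⟩ := (isCompact_closedBall x (M + 1)).exists_isMinOn hne
    (f := fun y => ‖F y - x‖) (by fun_prop)
  refine ⟨y, ?_⟩
  by_contra hxy
  have hpos : 0 < ‖F y - x‖ := norm_pos_iff.2 (sub_ne_zero.2 hxy)
  set δ := min 1 (‖F y - x‖ / 2) with hδ
  have hδ0 : 0 < δ := lt_min one_pos (by linarith)
  obtain ⟨e, he⟩ := happ δ hδ0
  have h1 := he (e.symm x)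
  rw [e.apply_symm_apply, norm_sub_rev] at h1
  have hmem : e.symm x ∈ Metric.closedBall x (M + 1) := by
    rw [mem_closedBall_iff_norm]
    calc ‖e.symm x - x‖ = ‖(F (e.symm x) - x) - (F (e.symm x) - e.symm x)‖ := by congr 1; abel
      _ ≤ _ := norm_sub_le _ _
      _ ≤ 1 + M := add_le_add (h1.trans (min_le_left _ _)) (hM _)
      _ = M + 1 := add_comm _ _
  have h2 := hmin hmem
  simp only [mem_ofPred_eq] at h2
  have h3 : δ ≤ ‖F y - x‖ / 2 := min_le_right _ _
  linarith

theorem aux_iso {E : Type*} [NormedAddCommGroup E] [NormedSpace ℝ E] [FiniteDimensional ℝ E]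
    (F : E → E) (hF : Continuous F)
    (happ : ∀ δ > (0:ℝ), ∃ e : E ≃ₜ E, ∀ x, ‖e x - F x‖ ≤ δ) (x y : E) (hy : F y = x)
    (hiso : ∀ᶠ z in 𝓝[≠] y, F z ≠ x) (y' : E) (hy' : F y' = x) : y' = y := by
  by_contra hne
  have : ProperSpace E := FiniteDimensional.proper ℝ E
  rw [eventually_nhdsWithin_iff, Metric.eventually_nhds_iff] at hiso
  obtain ⟨r, hr, hiso⟩ := hiso
  set ρ := r / 2 with hρ
  have hρ0 : 0 < ρ := by positivity
  have hdist : ρ < dist y' y := by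
    by_contra h
    exact hiso (y := y') (by linarith) hne hy'
  have hpos : ∃ m > (0:ℝ), ∀ z ∈ Metric.sphere y ρ, m ≤ ‖F z - x‖ := by
    rcases (Metric.sphere y ρ).eq_empty_or_nonempty with h | h
    · exact ⟨1, one_pos, by simp [h]⟩
    obtain ⟨z, hz, hmin⟩ := (isCompact_sphere y ρ).exists_isMinOn h
      (f := fun y => ‖F y - x‖) (by fun_prop)
    refine ⟨‖F z - x‖, ?_, fun w hw => hmin hw⟩
    refine norm_pos_iff.2 (sub_ne_zero.2 (hiso (y := z) ?_ ?_))
    · rw [Metric.mem_sphere] at hz; linarith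
    · rintro rfl
      simp at hz; linarith
  obtain ⟨m, hm, hms⟩ := hpos
  obtain ⟨e, he⟩ := happ (m / 3) (by positivity)
  have hc : IsPreconnected (e ⁻¹' Metric.closedBall x (m / 3)) :=
    e.isPreconnected_preimage.2 (convex_closedBall _ _).isPreconnected
  have m1 : y ∈ e ⁻¹' Metric.closedBall x (m / 3) := by
    rw [mem_preimage, mem_closedBall_iff_norm, ← hy]; exact he y
  have m2 : y' ∈ e ⁻¹' Metric.closedBall x (m / 3) := by
    rw [mem_preimage, mem_closedBall_iff_norm, ← hy']; exact he y'
  obtain ⟨p, hp, hpd⟩ := hc.intermediate_value m1 m2 (f := fun z => dist z y) (by fun_prop)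
    (show ρ ∈ _ by simp; exact ⟨hρ0.le, hdist.le⟩)
  have h1 := hms p hpd
  rw [mem_preimage, mem_closedBall_iff_norm] at hp
  have h2 := he p
  have : ‖F p - x‖ ≤ ‖e p - x‖ + ‖e p - F p‖ := by
    calc ‖F p - x‖ = ‖(e p - x) - (e p - F p)‖ := by congr 1; abel
      _ ≤ _ := norm_sub_le _ _
  linarith

theorem aux_null (F : V → V) (K : ℝ≥0) (hF : LipschitzWith K F) (s : Set V) (hs : volume s = 0) :
    volume (F '' s) = 0 := by
  set m : Measure V := μH[(Module.finrank ℝ V : ℝ)]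
  have h1 : m s = 0 := Measure.absolutelyContinuous_isAddHaarMeasure m volume hs
  refine Measure.absolutelyContinuous_isAddHaarMeasure volume m ?_
  have := (hF.lipschitzOnWith (s := s)).hausdorffMeasure_image_le
    (d := (Module.finrank ℝ V : ℝ)) (by positivity)
  change m (F '' s) ≤ _ * m s at this
  rw [h1, mul_zero] at this
  exact le_antisymm this bot_le

theorem aux_main (F : V → V) (K : ℝ≥0) (hF : LipschitzWith K F) (M : ℝ) (hM : ∀ x, ‖F x - x‖ ≤ M)
    (happ : ∀ δ > (0:ℝ), ∃ e : V ≃ₜ V, ∀ x, ‖e x - F x‖ ≤ δ) :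
    ∃ E : Set V, volume Eᶜ = 0 ∧ ∀ x ∈ E, ∃! y : V, F y = x := by
  set A : Set V := {y | ¬ DifferentiableAt ℝ F y}
  set B : Set V := {y | DifferentiableAt ℝ F y ∧ (fderiv ℝ F y).det = 0}
  have hA : volume (F '' A) = 0 :=
    aux_null d F K hF A (hF.ae_differentiableAt (μ := volume))
  have hB : volume (F '' B) = 0 :=
    addHaar_image_eq_zero_of_det_fderivWithin_eq_zero volume
      (fun y hy => hy.1.hasFDerivAt.hasFDerivWithinAt) (fun y hy => hy.2)
  refine ⟨(F '' A ∪ F '' B)ᶜ, by rw [compl_compl]; exact measure_union_null hA hB, ?_⟩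
  intro x hx
  obtain ⟨y, hy⟩ := aux_topo F hF.continuous M hM happ x
  refine ⟨y, hy, fun y' hy' => ?_⟩
  refine aux_iso F hF.continuous happ x y hy ?_ y' hy'
  have hyA : DifferentiableAt ℝ F y := by
    by_contra h
    exact hx (Or.inl ⟨y, h, hy⟩)
  have hyB : (fderiv ℝ F y).det ≠ 0 := fun h => hx (Or.inr ⟨y, ⟨hyA, h⟩, hy⟩)
  refine hyA.hasFDerivAt.eventually_ne ?_
  exact ⟨_, ((fderiv ℝ F y).toContinuousLinearEquivOfDetNeZero hyB).antilipschitz⟩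

theorem aux_homeo {E : Type*} [NormedAddCommGroup E] [NormedSpace ℝ E] [CompleteSpace E]
    (ψ : E → E) (K : ℝ≥0) (hK : K < 1) (h : LipschitzWith K ψ) :
    ∃ e : E ≃ₜ E, ∀ x, e x = x - ψ x := by
  have happ : ApproximatesLinearOn (fun x => x - ψ x)
      ((ContinuousLinearEquiv.refl ℝ E : E ≃L[ℝ] E) : E →L[ℝ] E) univ K := by
    refine LipschitzOnWith.approximatesLinearOn ?_
    have : ((fun x => x - ψ x) - ⇑((ContinuousLinearEquiv.refl ℝ E : E ≃L[ℝ] E) : E →L[ℝ] E))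
        = fun x => - ψ x := by
      ext x; simp
    rw [this]
    exact (h.neg).lipschitzOnWith
  rcases subsingleton_or_nontrivial E with hs | hs
  · exact ⟨Homeomorph.refl E, fun x => Subsingleton.elim _ _⟩
  refine ⟨happ.toHomeomorph _ (Or.inr ?_), fun x => rfl⟩
  have : ‖(((ContinuousLinearEquiv.refl ℝ E : E ≃L[ℝ] E).symm : E ≃L[ℝ] E) : E →L[ℝ] E)‖₊ = 1 := by
    ext; simp
  rw [this]; simpa using hK

theorem fil_mem {b : ℝ → V → V} {t : ℝ} {x p : V} (hp : p ∈ filippov d b t x) {δ : ℝ} (hδ : 0 < δ) :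
    p ∈ closure (convexHull ℝ (b t '' (Metric.ball x δ))) := by
  unfold filippov at hp
  simp only [mem_iInter] at hp
  have := hp δ hδ ∅ (by simp)
  simpa using this

theorem fil_ball {T C₀ : ℝ} {b : ℝ → V → V} (hb : HalfLipschitzField d T b C₀) {t : ℝ}
    (ht : t ∈ Icc (0:ℝ) T) {x p : V} (hp : p ∈ filippov d b t x) : ‖p‖ ≤ C₀ := by
  have h : closure (convexHull ℝ (b t '' (Metric.ball x 1))) ⊆ Metric.closedBall 0 C₀ := by
    refine closure_minimal (convexHull_min ?_ (convex_closedBall _ _)) Metric.isClosed_closedBall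
    rintro _ ⟨u, -, rfl⟩
    simpa using hb.bdd t ht u
  simpa using h (fil_mem d hp one_pos)

theorem fil_half {T C₀ : ℝ} {b : ℝ → V → V} (hb : HalfLipschitzField d T b C₀) {t : ℝ}
    (ht : t ∈ Icc (0:ℝ) T) {x y p q : V} (hp : p ∈ filippov d b t x) (hq : ‖q‖ ≤ C₀)
    (h : ∀ u, ⟪b t u - q, u - y⟫ ≥ -C₀ * ‖u - y‖ ^ 2) :
    ⟪p - q, x - y⟫ ≥ -C₀ * ‖x - y‖ ^ 2 := by
  have hC := hb.pos
  have key : ∀ δ > (0:ℝ), -C₀ * (‖x - y‖ + δ) ^ 2 - 2 * C₀ * δ ≤ ⟪x - y, p - q⟫ := by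
    intro δ hδ
    have hsub : closure (convexHull ℝ (b t '' (Metric.ball x δ))) ⊆
        {p : V | -C₀ * (‖x - y‖ + δ) ^ 2 - 2 * C₀ * δ + ⟪x - y, q⟫ ≤ ⟪x - y, p⟫} := by
      refine closure_minimal (convexHull_min ?_ ?_) ?_
      · rintro _ ⟨u, hu, rfl⟩
        rw [mem_ball_iff_norm] at hu
        have h1 := h u
        have h2 : ‖u - y‖ ≤ ‖x - y‖ + δ := by
          calc ‖u - y‖ = ‖(x - y) + (u - x)‖ := by congr 1; abel
            _ ≤ ‖x - y‖ + ‖u - x‖ := norm_add_le _ _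
            _ ≤ _ := by linarith
        have h3 : ⟪b t u - q, u - y⟫ = ⟪x - y, b t u⟫ - ⟪x - y, q⟫ + ⟪b t u - q, u - x⟫ := by
          rw [← inner_sub_right, real_inner_comm (b t u - q) (x - y), ← inner_add_right]
          congr 1; abel
        have h4 : ⟪b t u - q, u - x⟫ ≤ 2 * C₀ * δ := by
          refine (real_inner_le_norm _ _).trans ?_
          refine mul_le_mul ?_ hu.le (norm_nonneg _) (by positivity)
          refine (norm_sub_le _ _).trans ?_
          have := hb.bdd t ht u
          linarith
        have h5 : ‖u - y‖ ^ 2 ≤ (‖x - y‖ + δ) ^ 2 := by gcongr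
        have h6 := mul_le_mul_of_nonneg_left h5 hC.le
        rw [mem_ofPred_eq]
        linarith
      · exact convex_halfSpace_ge (innerSL ℝ (x - y)).isLinear _
      · exact isClosed_le continuous_const (by fun_prop)
    have := hsub (fil_mem d hp hδ)
    rw [inner_sub_right]
    rw [mem_ofPred_eq] at this
    linarith
  have hlim : Tendsto (fun δ : ℝ => -C₀ * (‖x - y‖ + δ) ^ 2 - 2 * C₀ * δ) (𝓝[>] 0)
      (𝓝 (-C₀ * (‖x - y‖ + 0) ^ 2 - 2 * C₀ * 0)) :=
    (Continuous.tendsto (by fun_prop) 0).mono_left nhdsWithin_le_nhds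
  have := le_of_tendsto hlim (eventually_nhdsWithin_of_forall (fun δ hδ => key δ hδ))
  rw [real_inner_comm]
  simpa using this

theorem fil_half1 {T C₀ : ℝ} {b : ℝ → V → V} (hb : HalfLipschitzField d T b C₀) {t : ℝ}
    (ht : t ∈ Icc (0:ℝ) T) {y q : V} (hq : q ∈ filippov d b t y) (u : V) :
    ⟪b t u - q, u - y⟫ ≥ -C₀ * ‖u - y‖ ^ 2 := by
  have := fil_half d hb ht (y := u) hq (hb.bdd t ht u) (fun v => hb.halfLip t ht v u)
  rw [← neg_sub (b t u) q, ← neg_sub u y, inner_neg_neg, norm_neg] at this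
  exact this

theorem fil_half2 {T C₀ : ℝ} {b : ℝ → V → V} (hb : HalfLipschitzField d T b C₀) {t : ℝ}
    (ht : t ∈ Icc (0:ℝ) T) {x y p q : V} (hp : p ∈ filippov d b t x) (hq : q ∈ filippov d b t y) :
    ⟪p - q, x - y⟫ ≥ -C₀ * ‖x - y‖ ^ 2 :=
  fil_half d hb ht hp (fil_ball d hb ht hq) (fil_half1 d hb ht hq)

theorem step_lem {m : ℝ → V} {a c D K κ η : ℝ} (hac : a ≤ c) (hK : 0 ≤ K) (hD : 0 ≤ D)
    (hm : IntegrableOn m (Ioc a c))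
    (hmD : ∀ᵐ r ∂(volume.restrict (Ioc a c)), ‖m r‖ ≤ D) {w w' : V}
    (hw : w' = w - ∫ r in Ioc a c, m r)
    (hv : ∀ᵐ r ∂(volume.restrict (Ioc a c)), ∃ v, ‖v - w‖ ≤ κ ∧ ⟪m r, v⟫ ≥ -K * ‖v‖ ^ 2 - η) :
    ‖w'‖ ^ 2 ≤ (1 + 4 * K * (c - a)) * ‖w‖ ^ 2
      + (c - a) * (4 * K * κ ^ 2 + 2 * η + 2 * D * κ + D ^ 2 * (c - a)) := by
  have hvol : volume.real (Ioc a c) = c - a := by simp [hac]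
  have h1 : ‖∫ r in Ioc a c, m r‖ ≤ D * (c - a) := by
    rw [← hvol]
    exact norm_setIntegral_le_of_norm_le_const_ae (by simp) hmD
  have h2 : (c - a) * (-(2 * K * ‖w‖ ^ 2 + 2 * K * κ ^ 2 + η + D * κ)) ≤
      ⟪w, ∫ r in Ioc a c, m r⟫ := by
    rw [← integral_inner hm w]
    have : ∫ r in Ioc a c, (-(2 * K * ‖w‖ ^ 2 + 2 * K * κ ^ 2 + η + D * κ))
        ≤ ∫ r in Ioc a c, ⟪w, m r⟫ := by
      refine integral_mono_ae (integrable_const _) (hm.const_inner w) ?_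
      filter_upwards [hmD, hv] with r hr ⟨v, hv1, hv2⟩
      have e1 : ⟪m r, v⟫ = ⟪w, m r⟫ + ⟪m r, v - w⟫ := by
        rw [real_inner_comm (m r) w, ← inner_add_right]; congr 1; abel
      have e2 : ⟪m r, v - w⟫ ≤ D * κ :=
        (real_inner_le_norm _ _).trans (mul_le_mul hr hv1 (norm_nonneg _) hD)
      have e3 : ‖v‖ ≤ ‖w‖ + κ := by
        calc ‖v‖ = ‖w + (v - w)‖ := by congr 1; abel
          _ ≤ ‖w‖ + ‖v - w‖ := norm_add_le _ _
          _ ≤ _ := by linarith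
      have e4 : ‖v‖ ^ 2 ≤ 2 * ‖w‖ ^ 2 + 2 * κ ^ 2 := by
        have : ‖v‖ ^ 2 ≤ (‖w‖ + κ) ^ 2 := by gcongr
        nlinarith [sq_nonneg (‖w‖ - κ)]
      have e5 := mul_le_mul_of_nonneg_left e4 hK
      linarith
    rw [setIntegral_const, hvol, smul_eq_mul] at this
    exact this
  have h3 : ‖∫ r in Ioc a c, m r‖ ^ 2 ≤ (D * (c - a)) ^ 2 := by gcongr
  rw [hw, norm_sub_sq_real]
  linarith

theorem moll {T C₀ : ℝ} {b : ℝ → V → V} (hb : HalfLipschitzField d T b C₀) (ε : ℝ) (hε : 0 < ε) :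
    ∃ B : ℝ → V → V, ∃ L : ℝ≥0, (∀ z, StronglyMeasurable (fun r => B r z)) ∧
      ∀ r ∈ Icc (0:ℝ) T, LipschitzWith L (B r) ∧ (∀ z, ‖B r z‖ ≤ C₀) ∧
        ∀ z y q, q ∈ filippov d b r y →
          ⟪B r z - q, z - y⟫ ≥ -(2 * C₀) * ‖z - y‖ ^ 2 - (2 * C₀ * ε ^ 2 + 2 * C₀ * ε) := by
  have hC := hb.pos
  let f : ContDiffBump (0 : V) := ⟨ε / 2, ε, by positivity, by linarith⟩
  set ρ : V → ℝ := f.normed volume with hρ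
  have hρ0 : ∀ x, 0 ≤ ρ x := f.nonneg_normed
  have hρc : Continuous ρ := f.continuous_normed
  have hρi : Integrable ρ := f.integrable_normed
  have hρ1 : ∫ x, ρ x = 1 := f.integral_normed
  have hsupp : ∀ x, ε ≤ ‖x‖ → ρ x = 0 := by
    intro x hx
    have : x ∉ Function.support ρ := by
      rw [hρ, f.support_normed_eq]
      simpa using hx
    simpa using this
  obtain ⟨K, hK⟩ : ∃ K, LipschitzWith K ρ :=
    ContDiff.lipschitzWith_of_hasCompactSupport (𝕂 := ℝ) f.hasCompactSupport_normed
      (f.contDiff_normed (n := 1)) (by simp)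
  have hbm : ∀ r, Measurable (b r) := fun r => hb.meas.comp measurable_prodMk_left
  have hρiz : ∀ z, Integrable (fun ζ => ρ (ζ - z)) := fun z => hρi.comp_sub_right z
  have hρ1z : ∀ z, ∫ ζ, ρ (ζ - z) = 1 := fun z => by
    rw [integral_sub_right_eq_self (fun ζ => ρ ζ) z, hρ1]
  have hint : ∀ r ∈ Icc (0:ℝ) T, ∀ z, Integrable (fun ζ => ρ (ζ - z) • b r ζ) := by
    intro r hr z
    refine (hρiz z).smul_bdd C₀ ?_ ?_
    · exact (hbm r).aestronglyMeasurable
    · exact Eventually.of_forall (hb.bdd r hr)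
  refine ⟨fun r z => ∫ ζ, ρ (ζ - z) • b r ζ,
    ⟨C₀ * K * (2 * volume.real (Metric.ball (0:V) ε)), by positivity⟩, ?_, ?_⟩
  · intro z
    refine StronglyMeasurable.integral_prod_right (f := fun r ζ => ρ (ζ - z) • b r ζ) ?_
    refine Measurable.stronglyMeasurable ?_
    have h1 : Measurable (fun p : ℝ × V => ρ (p.2 - z)) := hρc.measurable.comp (by fun_prop)
    exact h1.smul hb.meas
  intro r hr
  refine ⟨?_, ?_, ?_⟩
  · refine LipschitzWith.of_dist_le_mul fun z z' => ?_
    rw [dist_eq_norm, ← integral_sub (hint r hr z) (hint r hr z')]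
    set S := Metric.ball z ε ∪ Metric.ball z' ε with hS
    rw [← setIntegral_eq_integral_of_forall_compl_eq_zero (s := S)]
    · have hb1 : ∀ ζ ∈ S, ‖ρ (ζ - z) • b r ζ - ρ (ζ - z') • b r ζ‖ ≤ (K * dist z z') * C₀ := by
        intro ζ _
        rw [← sub_smul, norm_smul]
        refine mul_le_mul ?_ (hb.bdd r hr ζ) (norm_nonneg _) (by positivity)
        have := hK.dist_le_mul (ζ - z) (ζ - z')
        rwa [dist_sub_left, dist_eq_norm] at this
      refine (norm_setIntegral_le_of_norm_le_const ?_ hb1).trans ?_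
      · exact (measure_union_le _ _).trans_lt
          (ENNReal.add_lt_top.2 ⟨measure_ball_lt_top, measure_ball_lt_top⟩)
      have hv : volume.real S ≤ 2 * volume.real (Metric.ball (0:V) ε) := by
        refine (measureReal_union_le _ _).trans ?_
        have h0 : ∀ z : V, volume.real (Metric.ball z ε) = volume.real (Metric.ball (0:V) ε) :=
          fun z => by simp only [Measure.real, Measure.addHaar_ball_center]
        rw [h0 z, h0 z']; linarith
      calc _ ≤ (K * dist z z') * C₀ * (2 * volume.real (Metric.ball (0:V) ε)) := by gcongr
        _ = _ := by
          change _ = (C₀ * K * (2 * volume.real (Metric.ball (0:V) ε))) * _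
          ring
    · intro ζ hζ
      rw [hS, mem_union, not_or, mem_ball_iff_norm, mem_ball_iff_norm, not_lt, not_lt] at hζ
      rw [hsupp _ hζ.1, hsupp _ hζ.2]; simp
  · intro z
    refine (norm_integral_le_integral_norm _).trans ?_
    calc ∫ ζ, ‖ρ (ζ - z) • b r ζ‖ ≤ ∫ ζ, ρ (ζ - z) * C₀ := by
          refine integral_mono (hint r hr z).norm ((hρiz z).mul_const _) fun ζ => ?_
          simp only [norm_smul, Real.norm_of_nonneg (hρ0 _)]
          exact mul_le_mul_of_nonneg_left (hb.bdd r hr ζ) (hρ0 _)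
      _ = C₀ := by rw [integral_mul_const, hρ1z, one_mul]
  · intro z y q hq
    have hq0 := fil_ball d hb hr hq
    set β := 2 * C₀ * ‖z - y‖ ^ 2 + (2 * C₀ * ε ^ 2 + 2 * C₀ * ε)
    have hi1 : Integrable (fun ζ => ρ (ζ - z) • q) := (hρiz z).smul_const q
    have hq1 : ∫ ζ, ρ (ζ - z) • q = q := by rw [integral_smul_const, hρ1z, one_smul]
    have e1 : ⟪(∫ ζ, ρ (ζ - z) • b r ζ) - q, z - y⟫
        = ∫ ζ, ⟪z - y, ρ (ζ - z) • b r ζ - ρ (ζ - z) • q⟫ := by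
      have h1 := integral_inner (𝕜 := ℝ) ((hint r hr z).sub hi1) (z - y)
      simp only [Pi.sub_apply] at h1
      rw [h1, integral_sub (hint r hr z) hi1, hq1, real_inner_comm]
    have e2 : ∫ ζ, ρ (ζ - z) * (-β) ≤ ∫ ζ, ⟪z - y, ρ (ζ - z) • b r ζ - ρ (ζ - z) • q⟫ := by
      refine integral_mono ((hρiz z).mul_const _) (((hint r hr z).sub hi1).const_inner _) fun ζ => ?_
      simp only
      rw [← smul_sub, real_inner_smul_right]
      by_cases hζ : ε ≤ ‖ζ - z‖
      · rw [hsupp _ hζ]; simp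
      rw [not_le] at hζ
      refine mul_le_mul_of_nonneg_left ?_ (hρ0 _)
      have h1 := fil_half1 d hb hr hq ζ
      have h2 : ‖ζ - y‖ ≤ ‖z - y‖ + ε := by
        calc ‖ζ - y‖ = ‖(z - y) + (ζ - z)‖ := by congr 1; abel
          _ ≤ ‖z - y‖ + ‖ζ - z‖ := norm_add_le _ _
          _ ≤ _ := by linarith
      have h3 : ⟪b r ζ - q, ζ - y⟫ = ⟪z - y, b r ζ - q⟫ + ⟪b r ζ - q, ζ - z⟫ := by
        rw [real_inner_comm (b r ζ - q) (z - y), ← inner_add_right]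
        congr 1; abel
      have h4 : ⟪b r ζ - q, ζ - z⟫ ≤ 2 * C₀ * ε := by
        refine (real_inner_le_norm _ _).trans ?_
        refine mul_le_mul ?_ hζ.le (norm_nonneg _) (by positivity)
        refine (norm_sub_le _ _).trans ?_
        have := hb.bdd r hr ζ
        linarith
      have h5 : ‖ζ - y‖ ^ 2 ≤ 2 * ‖z - y‖ ^ 2 + 2 * ε ^ 2 := by
        have : ‖ζ - y‖ ^ 2 ≤ (‖z - y‖ + ε) ^ 2 := by gcongr
        nlinarith [sq_nonneg (‖z - y‖ - ε)]
      have h6 := mul_le_mul_of_nonneg_left h5 hC.le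
      simp only [β]
      linarith
    rw [integral_mul_const, hρ1z, one_mul, ← e1] at e2
    simp only [β] at e2
    simp only
    linarith

theorem sol_facts {T C₀ : ℝ} {b : ℝ → V → V} (hb : HalfLipschitzField d T b C₀) {t : ℝ}
    (ht : t ≤ T) {x : ℝ → V} (hx : IsFilippovSolOn d b x 0 t) :
    ∃ g : ℝ → V, ∀ a c, 0 ≤ a → a ≤ c → c ≤ t →
      IntegrableOn g (Ioc a c) ∧
      (∀ᵐ r ∂(volume.restrict (Ioc a c)), g r ∈ filippov d b r (x r) ∧ ‖g r‖ ≤ C₀) ∧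
      x c - x a = ∫ r in Ioc a c, g r := by
  obtain ⟨g, hg, hmem, hsol⟩ := hx
  refine ⟨g, fun a c ha hac hc => ?_⟩
  have hsub : Ioc a c ⊆ Ioc 0 t := Ioc_subset_Ioc ha hc
  have hgac := hg.mono_set hsub
  refine ⟨hgac, ?_, ?_⟩
  · filter_upwards [ae_restrict_of_ae_restrict_of_subset hsub hmem,
      ae_restrict_mem measurableSet_Ioc] with r hr hr2
    exact ⟨hr, fil_ball d hb ⟨ha.trans hr2.1.le, hr2.2.trans (hc.trans ht)⟩ hr⟩
  · rw [hsol c ⟨ha.trans hac, hc⟩, hsol a ⟨ha, hac.trans hc⟩, ← Ioc_union_Ioc_eq_Ioc ha hac,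
      setIntegral_union (Ioc_disjoint_Ioc_of_le le_rfl) measurableSet_Ioc
        (hg.mono_set (Ioc_subset_Ioc le_rfl (hac.trans hc))) hgac]
    abel

theorem sol_norm {T C₀ : ℝ} {b : ℝ → V → V} (hb : HalfLipschitzField d T b C₀) {t : ℝ}
    (ht : t ≤ T) {x : ℝ → V} (hx : IsFilippovSolOn d b x 0 t) {a c : ℝ} (ha : 0 ≤ a) (hac : a ≤ c)
    (hc : c ≤ t) : ‖x c - x a‖ ≤ C₀ * (c - a) := by
  obtain ⟨g, hg⟩ := sol_facts d hb ht hx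
  obtain ⟨-, h2, h3⟩ := hg a c ha hac hc
  have hvol : volume.real (Ioc a c) = c - a := by simp [hac]
  rw [h3, ← hvol]
  exact norm_setIntegral_le_of_norm_le_const_ae (by simp) (h2.mono fun r hr => hr.2)

theorem lip_step {T C₀ : ℝ} {b : ℝ → V → V} (hb : HalfLipschitzField d T b C₀) {t : ℝ}
    (ht : t ≤ T) {x y : ℝ → V} (hx : IsFilippovSolOn d b x 0 t) (hy : IsFilippovSolOn d b y 0 t)
    {a c : ℝ} (ha : 0 ≤ a) (hac : a ≤ c) (hc : c ≤ t) :
    ‖x a - y a‖ ^ 2 ≤ (1 + 8 * C₀ * (c - a)) * ‖x c - y c‖ ^ 2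
      + (c - a) * (32 * C₀ ^ 3 * (c - a) ^ 2 + 12 * C₀ ^ 2 * (c - a)) := by
  have hC := hb.pos
  obtain ⟨g, hg⟩ := sol_facts d hb ht hx
  obtain ⟨k, hk⟩ := sol_facts d hb ht hy
  obtain ⟨g1, g2, g3⟩ := hg a c ha hac hc
  obtain ⟨k1, k2, k3⟩ := hk a c ha hac hc
  have := step_lem d (m := fun r => g r - k r) (D := 2 * C₀) (K := 2 * C₀) (κ := 2 * C₀ * (c - a))
    (η := 0) (w := x c - y c) (w' := x a - y a) hac (by positivity) (by positivity) (g1.sub k1)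
    (by
      filter_upwards [g2, k2] with r h1 h2
      exact (norm_sub_le _ _).trans (by linarith [h1.2, h2.2]))
    (by
      rw [integral_sub g1 k1, ← g3, ← k3]; abel)
    (by
      filter_upwards [g2, k2, ae_restrict_mem measurableSet_Ioc] with r h1 h2 hr
      refine ⟨x r - y r, ?_, ?_⟩
      · have e1 := sol_norm d hb ht hx (ha.trans hr.1.le) hr.2 hc
        have e2 := sol_norm d hb ht hy (ha.trans hr.1.le) hr.2 hc
        have e3 : C₀ * (c - r) ≤ C₀ * (c - a) :=
          mul_le_mul_of_nonneg_left (by linarith [hr.1]) hC.le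
        calc ‖x r - y r - (x c - y c)‖ = ‖(y c - y r) - (x c - x r)‖ := by congr 1; abel
          _ ≤ _ := norm_sub_le _ _
          _ ≤ _ := by linarith
      · have := fil_half2 d hb ⟨ha.trans hr.1.le, hr.2.trans (hc.trans ht)⟩ h1.1 h2.1
        have e : 0 ≤ C₀ * ‖x r - y r‖ ^ 2 := by positivity
        linarith)
  refine this.trans (le_of_eq ?_)
  ring

theorem euler_step {T C₀ : ℝ} {b : ℝ → V → V} (hb : HalfLipschitzField d T b C₀) {t ε : ℝ}
    (ht : t ≤ T) {x : ℝ → V} (hx : IsFilippovSolOn d b x 0 t)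
    {B : ℝ → V → V} (hBm : ∀ z, StronglyMeasurable (fun r => B r z))
    (hB : ∀ r ∈ Icc (0:ℝ) T, (∀ z, ‖B r z‖ ≤ C₀) ∧
        ∀ z y q, q ∈ filippov d b r y →
          ⟪B r z - q, z - y⟫ ≥ -(2 * C₀) * ‖z - y‖ ^ 2 - (2 * C₀ * ε ^ 2 + 2 * C₀ * ε))
    {a c : ℝ} (ha : 0 ≤ a) (hac : a ≤ c) (hc : c ≤ t) (z : V) :
    ‖z - (∫ r in Ioc a c, B r z) - x a‖ ^ 2 ≤ (1 + 8 * C₀ * (c - a)) * ‖z - x c‖ ^ 2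
      + (c - a) * (32 * C₀ ^ 3 * (c - a) ^ 2 + 12 * C₀ ^ 2 * (c - a)
        + 2 * (2 * C₀ * ε ^ 2 + 2 * C₀ * ε)) := by
  have hC := hb.pos
  obtain ⟨g, hg⟩ := sol_facts d hb ht hx
  obtain ⟨g1, g2, g3⟩ := hg a c ha hac hc
  have hB1 : ∀ᵐ r ∂(volume.restrict (Ioc a c)), ‖B r z‖ ≤ C₀ := by
    filter_upwards [ae_restrict_mem measurableSet_Ioc] with r hr
    exact (hB r ⟨ha.trans hr.1.le, hr.2.trans (hc.trans ht)⟩).1 z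
  have k1 : IntegrableOn (fun r => B r z) (Ioc a c) :=
    Measure.integrableOn_of_bounded (by simp) (hBm z).aestronglyMeasurable hB1
  have := step_lem d (m := fun r => B r z - g r) (D := 2 * C₀) (K := 2 * C₀)
    (κ := 2 * C₀ * (c - a))
    (η := 2 * C₀ * ε ^ 2 + 2 * C₀ * ε) (w := z - x c) (w' := z - (∫ r in Ioc a c, B r z) - x a)
    hac (by positivity) (by positivity) (k1.sub g1)
    (by
      filter_upwards [g2, hB1] with r h1 h2
      exact (norm_sub_le _ _).trans (by linarith [h1.2, h2]))
    (by
      rw [integral_sub k1 g1, ← g3]; abel)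
    (by
      filter_upwards [g2, ae_restrict_mem measurableSet_Ioc] with r h1 hr
      refine ⟨z - x r, ?_, ?_⟩
      · have e1 := sol_norm d hb ht hx (ha.trans hr.1.le) hr.2 hc
        have e3 : C₀ * (c - r) ≤ C₀ * (c - a) :=
          mul_le_mul_of_nonneg_left (by linarith [hr.1]) hC.le
        have e4 : 0 ≤ C₀ * (c - a) := mul_nonneg hC.le (by linarith)
        calc ‖z - x r - (z - x c)‖ = ‖x c - x r‖ := by congr 1; abel
          _ ≤ _ := by linarith
      · exact (hB r ⟨ha.trans hr.1.le, hr.2.trans (hc.trans ht)⟩).2 z (x r) (g r) h1.1)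
  refine this.trans (le_of_eq ?_)
  ring

theorem gron {A η h α u u' k : ℝ} (hA : 0 ≤ A) (hη : 0 ≤ η) (hh : 0 ≤ h) (hα : 0 ≤ α) (hk : 0 ≤ k)
    (hu : u ≤ (A + η * (k * h)) * Real.exp (α * (k * h))) (hu' : u' ≤ (1 + α * h) * u + h * η) :
    u' ≤ (A + η * ((k + 1) * h)) * Real.exp (α * ((k + 1) * h)) := by
  have e1 : Real.exp (α * ((k + 1) * h)) = Real.exp (α * h) * Real.exp (α * (k * h)) := by
    rw [← Real.exp_add]; ring_nf
  have e2 : 1 + α * h ≤ Real.exp (α * h) := by linarith [Real.add_one_le_exp (α * h)]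
  have e3 : 1 ≤ Real.exp (α * ((k + 1) * h)) := Real.one_le_exp (by positivity)
  calc u' ≤ (1 + α * h) * u + h * η := hu'
    _ ≤ (1 + α * h) * ((A + η * (k * h)) * Real.exp (α * (k * h))) + h * η := by gcongr
    _ ≤ Real.exp (α * h) * ((A + η * (k * h)) * Real.exp (α * (k * h)))
        + h * η * Real.exp (α * ((k + 1) * h)) := by
      refine add_le_add ?_ (le_mul_of_one_le_right (by positivity) e3)
      gcongr
    _ = _ := by rw [e1]; ring

theorem lip_flow {T C₀ : ℝ} {b : ℝ → V → V} (hb : HalfLipschitzField d T b C₀) {s t : ℝ}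
    (hs : 0 ≤ s) (hst : s < t)
    (ht : t ≤ T) {x y : ℝ → V} (hx : IsFilippovSolOn d b x 0 t) (hy : IsFilippovSolOn d b y 0 t) :
    ‖x s - y s‖ ≤ Real.exp (4 * C₀ * (t - s)) * ‖x t - y t‖ := by
  have hC := hb.pos
  have key : ∀ h > 0, ∀ n : ℕ, s = t - n * h → ‖x s - y s‖ ^ 2 ≤
      (‖x t - y t‖ ^ 2 + (32 * C₀ ^ 3 * h ^ 2 + 12 * C₀ ^ 2 * h) * (t - s)) *
        Real.exp (8 * C₀ * (t - s)) := by
    intro h hh n hn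
    have ind : ∀ k : ℕ, k ≤ n → ‖x (t - k * h) - y (t - k * h)‖ ^ 2 ≤
      (‖x t - y t‖ ^ 2 + (32 * C₀ ^ 3 * h ^ 2 + 12 * C₀ ^ 2 * h) * (k * h)) *
        Real.exp (8 * C₀ * (k * h)) := by
      intro k
      induction k with
      | zero => intro _; simp
      | succ k ih =>
        intro hk
        have h0 : s ≤ t - ((k:ℝ) + 1) * h := by
          rw [hn]
          have : ((k:ℝ) + 1) ≤ n := by exact_mod_cast hk
          have := mul_le_mul_of_nonneg_right this hh.le
          linarith
        have h1 := lip_step d hb ht hx hy (a := t - ((k:ℝ) + 1) * h) (c := t - k * h)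
          (hs.trans h0) (by linarith) (by have : 0 ≤ k * h := by positivity
                                          linarith)
        have h2 : t - k * h - (t - ((k:ℝ) + 1) * h) = h := by ring
        rw [h2] at h1
        push_cast
        exact gron (by positivity) (by positivity) hh.le (by positivity) (by positivity)
          (ih (by omega)) h1
    have := ind n le_rfl
    rw [← hn] at this
    rw [show t - s = n * h by linarith]
    exact this
  have hlim : Tendsto (fun n : ℕ => (‖x t - y t‖ ^ 2 + (32 * C₀ ^ 3 * ((t - s) / (n + 1 : ℝ)) ^ 2
      + 12 * C₀ ^ 2 * ((t - s) / (n + 1 : ℝ))) * (t - s)) * Real.exp (8 * C₀ * (t - s))) atTop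
      (𝓝 ((‖x t - y t‖ ^ 2 + (32 * C₀ ^ 3 * 0 ^ 2
      + 12 * C₀ ^ 2 * 0) * (t - s)) * Real.exp (8 * C₀ * (t - s)))) := by
    have h0 : Tendsto (fun n : ℕ => (t - s) / (n + 1 : ℝ)) atTop (𝓝 0) :=
      by simpa [div_eq_mul_inv] using
        (tendsto_one_div_add_atTop_nhds_zero_nat (𝕜 := ℝ)).const_mul (t - s)
    exact ((((h0.pow 2).const_mul _).add (h0.const_mul _)).mul_const _ |>.const_add _).mul_const _
  have hle := ge_of_tendsto hlim (Eventually.of_forall fun n => key ((t - s) / (n + 1 : ℝ))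
    (div_pos (by linarith) (by positivity)) (n + 1) (by push_cast; field_simp; ring))
  refine (sq_le_sq₀ (norm_nonneg _) (by positivity)).1 ?_
  refine hle.trans (le_of_eq ?_)
  rw [mul_pow, ← Real.exp_nat_mul]
  push_cast
  ring_nf

theorem app_flow {T C₀ : ℝ} {b : ℝ → V → V} (hb : HalfLipschitzField d T b C₀) {s t : ℝ}
    (hs : 0 ≤ s) (hst : s < t)
    (ht : t ≤ T) {X : V → ℝ → V} (hX : ∀ x, IsFilippovSolOn d b (X x) 0 t ∧ X x t = x)
    (δ : ℝ) (hδ : 0 < δ) : ∃ e : V ≃ₜ V, ∀ x, ‖e x - X x s‖ ≤ δ := by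
  have hC := hb.pos
  have hts : 0 < t - s := by linarith
  set R := (t - s) * Real.exp (8 * C₀ * (t - s)) with hR
  -- choice of the mollification parameter
  obtain ⟨ε, hε, hεδ⟩ : ∃ ε > 0, 2 * (2 * C₀ * ε ^ 2 + 2 * C₀ * ε) * R < δ ^ 2 / 2 := by
    have hl : Tendsto (fun ε : ℝ => 2 * (2 * C₀ * ε ^ 2 + 2 * C₀ * ε) * R) (𝓝[>] 0)
        (𝓝 (2 * (2 * C₀ * 0 ^ 2 + 2 * C₀ * 0) * R)) :=
      (Continuous.tendsto (by fun_prop) 0).mono_left nhdsWithin_le_nhds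
    have := hl.eventually_lt_const (u := δ ^ 2 / 2) (by simp; positivity)
    obtain ⟨ε, h1, h2⟩ := (this.and self_mem_nhdsWithin).exists
    exact ⟨ε, h2, h1⟩
  obtain ⟨B, L, hBm, hB⟩ := moll d hb ε hε
  obtain ⟨n, hn1, hn2⟩ : ∃ n : ℕ, L * ((t - s) / (n + 1 : ℝ)) < 1 ∧
      (32 * C₀ ^ 3 * ((t - s) / (n + 1 : ℝ)) ^ 2 + 12 * C₀ ^ 2 * ((t - s) / (n + 1 : ℝ))) * R
        < δ ^ 2 / 2 := by
    have h0 : Tendsto (fun n : ℕ => (t - s) / (n + 1 : ℝ)) atTop (𝓝 0) :=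
      by simpa [div_eq_mul_inv] using
        (tendsto_one_div_add_atTop_nhds_zero_nat (𝕜 := ℝ)).const_mul (t - s)
    have e1 := (h0.const_mul (L : ℝ)).eventually_lt_const (u := 1) (by simp)
    have e2 := ((((h0.pow 2).const_mul (32 * C₀ ^ 3)).add
      (h0.const_mul (12 * C₀ ^ 2))).mul_const R).eventually_lt_const
        (u := δ ^ 2 / 2) (by simp; positivity)
    exact (e1.and e2).exists
  set h := (t - s) / (n + 1 : ℝ) with hh
  have hh0 : 0 < h := div_pos hts (by positivity)
  have hnh : ((n:ℝ) + 1) * h = t - s := by rw [hh]; field_simp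
  set η := 32 * C₀ ^ 3 * h ^ 2 + 12 * C₀ ^ 2 * h + 2 * (2 * C₀ * ε ^ 2 + 2 * C₀ * ε) with hη
  have ind : ∀ k : ℕ, k ≤ n + 1 → ∃ e : V ≃ₜ V, ∀ x, ‖e x - X x (t - k * h)‖ ^ 2 ≤
      (0 + η * (k * h)) * Real.exp (8 * C₀ * (k * h)) := by
    intro k
    induction k with
    | zero =>
      intro _
      refine ⟨Homeomorph.refl V, fun x => ?_⟩
      simp [(hX x).2]
    | succ k ih =>
      intro hk
      obtain ⟨e, he⟩ := ih (by omega)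
      have h0 : s ≤ t - ((k:ℝ) + 1) * h := by
        have : ((k:ℝ) + 1) ≤ n + 1 := by exact_mod_cast hk
        have := mul_le_mul_of_nonneg_right this hh0.le
        linarith
      have hkh : 0 ≤ k * h := by positivity
      set a := t - ((k:ℝ) + 1) * h with ha
      set c := t - k * h with hc
      have hac : c - a = h := by rw [ha, hc]; ring
      have hIcc : ∀ r ∈ Ioc a c, r ∈ Icc (0:ℝ) T := fun r hr =>
        ⟨by linarith [hr.1], by linarith [hr.2]⟩
      have hint : ∀ z, IntegrableOn (fun r => B r z) (Ioc a c) := fun z =>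
        Measure.integrableOn_of_bounded (M := C₀) (by simp) (hBm z).aestronglyMeasurable (by
          filter_upwards [ae_restrict_mem measurableSet_Ioc] with r hr
          exact (hB r (hIcc r hr)).2.1 z)
      have hlip : LipschitzWith (L * h.toNNReal) (fun z => ∫ r in Ioc a c, B r z) := by
        refine LipschitzWith.of_dist_le_mul fun z z' => ?_
        rw [dist_eq_norm, ← integral_sub (hint z) (hint z')]
        have hvol : volume.real (Ioc a c) = h := by
          rw [← hac]; simp; linarith
        refine (norm_setIntegral_le_of_norm_le_const (C := L * dist z z') (by simp) ?_).trans ?_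
        · intro r hr
          rw [← dist_eq_norm]
          exact (hB r (hIcc r hr)).1.dist_le_mul z z'
        · rw [hvol]
          push_cast
          rw [Real.coe_toNNReal _ hh0.le]
          exact le_of_eq (by ring)
      obtain ⟨e', he'⟩ := aux_homeo _ _ (by
        rw [← NNReal.coe_lt_coe]; push_cast; rw [Real.coe_toNNReal _ hh0.le]; exact hn1) hlip
      refine ⟨e.trans e', fun x => ?_⟩
      have h1 := euler_step d hb ht (hX x).1 hBm (fun r hr => (hB r hr).2)
        (a := a) (c := c) (hs.trans h0) (by linarith) (by linarith) (e x)
      rw [hac] at h1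
      push_cast
      rw [Homeomorph.trans_apply, he']
      exact gron le_rfl (by positivity) hh0.le (by positivity) (by positivity) (he x) h1
  obtain ⟨e, he⟩ := ind (n + 1) le_rfl
  refine ⟨e, fun x => ?_⟩
  have h1 := he x
  push_cast at h1
  rw [hnh, sub_sub_cancel] at h1
  refine (sq_le_sq₀ (norm_nonneg _) hδ.le).1 (h1.trans ?_)
  have : (0 + η * (t - s)) * Real.exp (8 * C₀ * (t - s)) = η * R := by rw [hR]; ring
  rw [this, hη, add_mul]
  linarith
/-- Lemma A.3 / `remlem.1`: if `b` is a bounded Borel vector field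
satisfying the half-Lipschitz condition from below and `X` is the backward Filippov flow
of `b`, then for any `s < t` in `[0,T]` there is a set `E_{s,t}` of full Lebesgue measure
on which the preimage `X^{-1}(·, t, s)` is a singleton. -/
theorem backward_filippov_flow_ae_injective
    (T : ℝ) (hT : 0 < T) (b : ℝ → V → V) (C₀ : ℝ)
    (hb : HalfLipschitzField d T b C₀)
    (X : V → ℝ → ℝ → V) (hX : IsBackwardFilippovFlow d T b X) :
    ∀ s t : ℝ, 0 ≤ s → s < t → t ≤ T →
      ∃ E : Set V, volume Eᶜ = 0 ∧ ∀ x ∈ E, ∃! y : V, X y t s = x := by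
  intro s t hs hst ht
  have hC := hb.pos
  have hX' : ∀ x, IsFilippovSolOn d b (X x t) 0 t ∧ X x t t = x :=
    fun x => hX x t ⟨hs.trans hst.le, ht⟩
  refine aux_main d (fun y => X y t s) ⟨Real.exp (4 * C₀ * (t - s)), (Real.exp_pos _).le⟩ ?_
    (C₀ * (t - s)) ?_ ?_
  · refine LipschitzWith.of_dist_le_mul fun x y => ?_
    have := lip_flow d hb hs hst ht (hX' x).1 (hX' y).1
    rw [(hX' x).2, (hX' y).2] at this
    rw [dist_eq_norm, dist_eq_norm]
    exact this
  · intro x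
    have := sol_norm d hb ht (hX' x).1 hs hst.le le_rfl
    rw [(hX' x).2, norm_sub_rev] at this
    exact this
  · exact app_flow d hb hs hst ht (X := fun x => X x t) hX'
end
end

section
/- Let b: [0,T]×ℝ^d → ℝ^d be a bounded Borel vector field satisfying the half-Lipschitz condition from below. Then there exists a set E ⊂ ℝ^d of full Lebesgue measure such that for every x ∈ E there exists a unique forward maximal absolutely continuous solution of the Filippov differential inclusion ẋ_t ∈ b^F_t(x_t) on [0,T] with x_0 = x. -/
open MeasureTheory Filter Set
open scoped ENNReal NNReal Topology RealInnerProductSpace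

noncomputable section

variable (d : ℕ)

local notation "V" => EuclideanSpace ℝ (Fin d)

section helpers

variable {d}

structure GField (b : ℝ → V → V) (C : ℝ) : Prop where
  pos : 0 < C
  meas : Measurable (Function.uncurry b)
  bdd : ∀ t, ∀ x : V, ‖b t x‖ ≤ C
  halfLip : ∀ t, ∀ x y : V, ⟪b t x - b t y, x - y⟫ ≥ -C * ‖x - y‖ ^ 2

def Hull (b : ℝ → V → V) (t : ℝ) (x : V) (η : ℝ) : Set V :=
  closure (convexHull ℝ (b t '' Metric.ball x η))

def Appr (b : ℝ → V → V) (C T η : ℝ) (γ : ℝ → V) : Prop :=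
  LipschitzOnWith C.toNNReal γ (Icc 0 T) ∧
    ∀ᵐ s, s ∈ Ioc 0 T → ∃ v, HasDerivAt γ v s ∧ v ∈ Hull b s (γ s) η

lemma hull_convex (b : ℝ → V → V) (t : ℝ) (x : V) (η : ℝ) : Convex ℝ (Hull b t x η) :=
  (convex_convexHull ℝ _).closure

lemma hull_closed (b : ℝ → V → V) (t : ℝ) (x : V) (η : ℝ) : IsClosed (Hull b t x η) :=
  isClosed_closure

lemma hull_subset {b : ℝ → V → V} {t : ℝ} {x : V} {η : ℝ} {K : Set V} (hK : Convex ℝ K)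
    (hc : IsClosed K) (h : ∀ p ∈ Metric.ball x η, b t p ∈ K) : Hull b t x η ⊆ K := by
  refine closure_minimal (convexHull_min ?_ hK) hc
  rintro _ ⟨p, hp, rfl⟩
  exact h p hp

lemma mem_hull {b : ℝ → V → V} {t : ℝ} {x p : V} {η : ℝ} (h : p ∈ Metric.ball x η) :
    b t p ∈ Hull b t x η :=
  subset_closure (subset_convexHull ℝ _ ⟨p, h, rfl⟩)

lemma hull_mono {b : ℝ → V → V} {t : ℝ} {x y : V} {η η' : ℝ}
    (h : Metric.ball x η ⊆ Metric.ball y η') : Hull b t x η ⊆ Hull b t y η' :=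
  hull_subset (hull_convex _ _ _ _) (hull_closed _ _ _ _) fun _ hp => mem_hull (h hp)

lemma hull_bdd {b : ℝ → V → V} {C : ℝ} (hb : GField b C) {t : ℝ} {x : V} {η : ℝ} {v : V}
    (hv : v ∈ Hull b t x η) : ‖v‖ ≤ C := by
  have := hull_subset (b := b) (t := t) (x := x) (η := η) (convex_closedBall (0 : V) C)
    Metric.isClosed_closedBall (fun p _ => by simpa using hb.bdd t p) hv
  simpa using this

lemma filippov_subset_hull {b : ℝ → V → V} {t : ℝ} {x : V} {η : ℝ} (hη : 0 < η) :
    filippov d b t x ⊆ Hull b t x η := by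
  intro v hv
  simp only [filippov, mem_iInter] at hv
  have := hv η hη ∅ (by simp)
  simpa [Hull] using this

lemma Appr.mono {b : ℝ → V → V} {C T η η' : ℝ} {γ : ℝ → V} (h : Appr b C T η γ) (hη : η ≤ η') :
    Appr b C T η' γ := by
  refine ⟨h.1, ?_⟩
  filter_upwards [h.2] with s hs hs'
  obtain ⟨v, h1, h2⟩ := hs hs'
  exact ⟨v, h1, hull_mono (Metric.ball_subset_ball hη) h2⟩

/-- the key one-sided inequality -/
lemma key_ineq {b : ℝ → V → V} {C : ℝ} (hb : GField b C) {t : ℝ} {x y v w : V} {η : ℝ}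
    (h1 : η ≤ 1) (hv : v ∈ Hull b t x η) (hw : w ∈ Hull b t y η) :
    -(2 * C) * ‖x - y‖ ^ 2 - 12 * C * η ≤ ⟪v - w, x - y⟫ := by
  have hC := hb.pos
  have base : ∀ p ∈ Metric.ball x η, ∀ q ∈ Metric.ball y η,
      -(2 * C) * ‖x - y‖ ^ 2 - 12 * C * η ≤ ⟪b t p - b t q, x - y⟫ := by
    intro p hp q hq
    rw [mem_ball_iff_norm] at hp hq
    have hη : 0 ≤ η := (norm_nonneg _).trans hp.le
    have e : ⟪b t p - b t q, x - y⟫ = ⟪b t p - b t q, p - q⟫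
        - ⟪b t p - b t q, (p - x) - (q - y)⟫ := by
      rw [← inner_sub_right]; congr 1; abel
    have i1 := hb.halfLip t p q
    have i2 : ⟪b t p - b t q, (p - x) - (q - y)⟫ ≤ (C + C) * (η + η) := by
      refine (real_inner_le_norm _ _).trans ?_
      have a1 : ‖b t p - b t q‖ ≤ C + C :=
        (norm_sub_le _ _).trans (add_le_add (hb.bdd t p) (hb.bdd t q))
      have a2 : ‖(p - x) - (q - y)‖ ≤ η + η :=
        (norm_sub_le _ _).trans (add_le_add hp.le hq.le)
      gcongr
    have i3 : ‖p - q‖ ≤ ‖x - y‖ + 2 * η := by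
      have : p - q = (x - y) + ((p - x) - (q - y)) := by abel
      rw [this]
      refine (norm_add_le _ _).trans ?_
      have := (norm_sub_le (p - x) (q - y)).trans (add_le_add hp.le hq.le)
      linarith
    have i4 : ‖p - q‖ ^ 2 ≤ 2 * ‖x - y‖ ^ 2 + 8 * η := by
      have : ‖p - q‖ ^ 2 ≤ (‖x - y‖ + 2 * η) ^ 2 := by gcongr
      nlinarith [sq_nonneg (‖x - y‖ - 2 * η)]
    rw [e]
    nlinarith
  have step1 : ∀ v ∈ Hull b t x η, ∀ q ∈ Metric.ball y η,
      -(2 * C) * ‖x - y‖ ^ 2 - 12 * C * η ≤ ⟪v - b t q, x - y⟫ := by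
    intro v hv q hq
    have := hull_subset (K := {v : V | -(2 * C) * ‖x - y‖ ^ 2 - 12 * C * η + ⟪b t q, x - y⟫
      ≤ ⟪v, x - y⟫})
      (by
        have := convex_halfSpace_ge (𝕜 := ℝ) (f := fun v : V => ⟪v, x - y⟫)
          ⟨fun a b => inner_add_left _ _ _, fun c a => by simp [inner_smul_left]⟩
          (-(2 * C) * ‖x - y‖ ^ 2 - 12 * C * η + ⟪b t q, x - y⟫)
        exact this)
      (isClosed_le continuous_const (by fun_prop))
      (fun p hp => by have := base p hp q hq; rw [inner_sub_left] at this; simp only [mem_ofPred_eq]; linarith) hv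
    simp only [mem_ofPred_eq] at this
    rw [inner_sub_left]; linarith
  have := hull_subset (K := {w : V | ⟪w, x - y⟫ ≤ ⟪v, x - y⟫ - (-(2 * C) * ‖x - y‖ ^ 2 - 12 * C * η)})
      (by
        have := convex_halfSpace_le (𝕜 := ℝ) (f := fun v : V => ⟪v, x - y⟫)
          ⟨fun a b => inner_add_left _ _ _, fun c a => by simp [inner_smul_left]⟩
          (⟪v, x - y⟫ - (-(2 * C) * ‖x - y‖ ^ 2 - 12 * C * η))
        exact this)
      (isClosed_le (by fun_prop) continuous_const)
      (fun p hp => by have := step1 v hv p hp; rw [inner_sub_left] at this; simp only [mem_ofPred_eq]; linarith) hw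
  simp only [mem_ofPred_eq] at this
  rw [inner_sub_left]; linarith

lemma ac_ge {w f : ℝ → ℝ} {a c : ℝ} (hac : a ≤ c) (hw : AbsolutelyContinuousOnInterval w a c)
    (hf : IntervalIntegrable f volume a c)
    (h : ∀ᵐ s, s ∈ Ioc a c → ∃ v, HasDerivAt w v s ∧ f s ≤ v) :
    ∫ s in a..c, f s ≤ w c - w a := by
  rw [← hw.integral_deriv_eq_sub]
  refine intervalIntegral.integral_mono_ae_restrict hac hf hw.intervalIntegrable_deriv ?_
  rw [Filter.EventuallyLE, ← restrict_Ioc_eq_restrict_Icc, ae_restrict_iff' measurableSet_Ioc]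
  filter_upwards [h] with s hs hs'
  obtain ⟨v, h1, h2⟩ := hs hs'
  rwa [h1.deriv]

lemma ac_norm_sq {u : ℝ → V} {K : ℝ≥0} {a c : ℝ} (h : LipschitzOnWith K u (uIcc a c)) :
    AbsolutelyContinuousOnInterval (fun t => ‖u t‖ ^ 2) a c := by
  have h1 : LipschitzOnWith K (fun t => ‖u t‖) (uIcc a c) := by
    have := lipschitzWith_one_norm.comp_lipschitzOnWith h
    simpa [Function.comp_def] using this
  have := h1.absolutelyContinuousOnInterval.mul h1.absolutelyContinuousOnInterval
  have e : (fun t => ‖u t‖ ^ 2) = (fun t => ‖u t‖) * (fun t => ‖u t‖) := by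
    ext t; simp [sq]
  rw [e]; exact this

/-- stability backwards -/
lemma stability {b : ℝ → V → V} {C : ℝ} (hb : GField b C) {T η : ℝ} (h0 : 0 < η)
    (h1 : η ≤ 1) {γ γ' : ℝ → V} (hγ : Appr b C T η γ) (hγ' : Appr b C T η γ') :
    ∀ t ∈ Icc 0 T, ‖γ t - γ' t‖ ^ 2 ≤
      Real.exp (4 * C * T) * (‖γ T - γ' T‖ ^ 2 + 24 * C * T * η) := by
  intro t ht
  have hC := hb.pos
  have hT : 0 ≤ T := ht.1.trans ht.2
  have hL : LipschitzOnWith (C.toNNReal + C.toNNReal) (fun s => γ s - γ' s) (uIcc t T) := by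
    rw [uIcc_of_le ht.2]
    exact (hγ.1.sub hγ'.1).mono (Icc_subset_Icc_left ht.1)
  have hE : AbsolutelyContinuousOnInterval (fun s => Real.exp (4 * C * s)) t T :=
    ContDiffOn.absolutelyContinuousOnInterval (by fun_prop)
  have hw := hE.mul (ac_norm_sq hL)
  have key := ac_ge (f := fun s => - (24 * C * η * Real.exp (4 * C * T))) ht.2 hw (by simp) ?_
  · simp only [intervalIntegral.integral_const, smul_eq_mul, Pi.mul_apply] at key
    have e1 : 1 ≤ Real.exp (4 * C * t) := Real.one_le_exp (by have := ht.1; positivity)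
    have e2 := Real.exp_pos (4 * C * T)
    have : ‖γ t - γ' t‖ ^ 2 ≤ Real.exp (4 * C * t) * ‖γ t - γ' t‖ ^ 2 := by
      nlinarith [sq_nonneg (‖γ t - γ' t‖)]
    have : (T - t) * (24 * C * η * Real.exp (4 * C * T)) ≤ T * (24 * C * η * Real.exp (4 * C * T)) := by
      have := ht.1
      gcongr; linarith
    nlinarith
  · filter_upwards [hγ.2, hγ'.2] with s hs hs' hm
    have hm' : s ∈ Ioc 0 T := ⟨ht.1.trans_lt hm.1, hm.2⟩
    obtain ⟨v, d1, m1⟩ := hs hm'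
    obtain ⟨w, d2, m2⟩ := hs' hm'
    have D := (((hasDerivAt_id s).const_mul (4 * C)).exp).mul (d1.sub d2).norm_sq
    refine ⟨_, D, ?_⟩
    have k := key_ineq hb h1 m1 m2
    simp only [id, mul_one, Pi.sub_apply]
    rw [real_inner_comm] at k
    set E := Real.exp (4 * C * s)
    have hE1 : E ≤ Real.exp (4 * C * T) := by
      apply Real.exp_le_exp.2; have := hm.2; gcongr
    have hE0 : 0 < E := Real.exp_pos _
    have : 24 * C * η * E ≤ 24 * C * η * Real.exp (4 * C * T) := by gcongr
    nlinarith

/-- integral representation gives `Appr`. -/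
lemma appr_of_integral {b : ℝ → V → V} {C : ℝ} (hb : GField b C) {T η : ℝ} (hT : 0 < T)
    {γ g : ℝ → V} (hg : IntegrableOn g (Ioc 0 T))
    (hm : ∀ᵐ s ∂(volume.restrict (Ioc 0 T)), g s ∈ Hull b s (γ s) η)
    (hγ : ∀ t ∈ Icc 0 T, γ t = γ 0 + ∫ s in Ioc 0 t, g s) : Appr b C T η γ := by
  have hI : IntervalIntegrable g volume 0 T := by
    rw [intervalIntegrable_iff_integrableOn_Ioc_of_le hT.le]; exact hg
  rw [ae_restrict_iff' measurableSet_Ioc] at hm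
  have hγ2 : ∀ t ∈ Icc 0 T, γ t = γ 0 + ∫ s in (0:ℝ)..t, g s := fun t ht => by
    rw [hγ t ht, intervalIntegral.integral_of_le ht.1]
  have sub : ∀ t ∈ Icc 0 T, IntervalIntegrable g volume 0 t := fun t ht =>
    hI.mono_set (by rw [uIcc_of_le ht.1, uIcc_of_le hT.le]; exact Icc_subset_Icc_right ht.2)
  constructor
  · refine LipschitzOnWith.of_dist_le_mul ?_
    intro x hx y hy
    rw [Real.coe_toNNReal _ hb.pos.le, dist_eq_norm, Real.dist_eq, hγ2 x hx, hγ2 y hy,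
      add_sub_add_left_eq_sub, intervalIntegral.integral_interval_sub_left (sub x hx) (sub y hy)]
    apply intervalIntegral.norm_integral_le_of_norm_le_const_ae
    filter_upwards [hm] with s hs hs'
    refine hull_bdd hb (hs ?_)
    rcases le_total x y with h | h
    · rw [uIoc_comm, uIoc_of_le h] at hs'
      exact ⟨hx.1.trans_lt hs'.1, hs'.2.trans hy.2⟩
    · rw [uIoc_of_le h] at hs'
      exact ⟨hy.1.trans_lt hs'.1, hs'.2.trans hx.2⟩
  · have hne : ∀ᵐ s : ℝ, s ≠ T := by simp [ae_iff, measure_singleton]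
    filter_upwards [hm, hI.ae_hasDerivAt_integral, hne] with s hs hd hsT hs'
    refine ⟨g s, ?_, hs hs'⟩
    have hd' := hd (by rw [uIcc_of_le hT.le]; exact Ioc_subset_Icc_self hs') 0 (by simp)
    refine (hd'.const_add (γ 0)).congr_of_eventuallyEq ?_
    filter_upwards [Icc_mem_nhds hs'.1 (lt_of_le_of_ne hs'.2 hsT)] with t ht
    exact hγ2 t ht

lemma appr_of_sol {b : ℝ → V → V} {C : ℝ} (hb : GField b C) {T η : ℝ} (hT : 0 < T)
    (hη : 0 < η) {γ : ℝ → V} (h : IsFilippovSolOn d b γ 0 T) : Appr b C T η γ := by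
  obtain ⟨g, h1, h2, h3⟩ := h
  refine appr_of_integral hb hT h1 ?_ h3
  filter_upwards [h2] with s hs
  exact filippov_subset_hull hη hs

lemma mem_filippov {b : ℝ → V → V} {C : ℝ} (hb : GField b C) {t : ℝ} {x v : V} {K : ℝ}
    (hK : 0 < K)
    (h : ∀ᵐ p : V, -K * ‖x - p‖ ^ 2 ≤ ⟪v - b t p, x - p⟫) : v ∈ filippov d b t x := by
  simp only [filippov, mem_iInter]
  intro δ hδ N hN
  have hδ : 0 < δ := hδ
  have hN : volume N = 0 := hN
  by_contra hv
  obtain ⟨f, u, hu1, hu2⟩ := geometric_hahn_banach_closed_point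
    ((convex_convexHull ℝ (b t '' (Metric.ball x δ \ N))).closure) isClosed_closure hv
  set e : V := (InnerProductSpace.toDual ℝ V).symm f with he
  have hfe : ∀ w, f w = ⟪e, w⟫ := fun w => by simp [he]
  set c := f v - u with hc
  have hc0 : 0 < c := by linarith
  set R := ‖v‖ + C with hR
  have hR0 : 0 < R := by have := hb.pos; positivity
  -- size parameters
  set κ := c / (2 * R) with hκ
  have hκ0 : 0 < κ := by positivity
  set A := ‖e‖ + κ with hA
  have hA0 : 0 < A := by positivity
  obtain ⟨τ, hτ0, hτ1, hτ2⟩ : ∃ τ > 0, τ * A < δ ∧ K * τ * A ^ 2 < c / 2 := by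
    refine ⟨min (δ / (2 * A)) (c / (4 * K * A ^ 2)), by positivity, ?_, ?_⟩
    · calc _ ≤ δ / (2 * A) * A := by gcongr; exact min_le_left _ _
        _ = δ / 2 := by field_simp
        _ < δ := by linarith
    · calc _ ≤ K * (c / (4 * K * A ^ 2)) * A ^ 2 := by gcongr; exact min_le_right _ _
        _ = c / 4 := by field_simp
        _ < c / 2 := by linarith
  have hpos : volume (Metric.ball (x + τ • e) (τ * κ)) ≠ 0 :=
    (Metric.measure_ball_pos volume _ (by positivity)).ne'
  have hNae : ∀ᵐ p : V, p ∉ N := measure_eq_zero_iff_ae_notMem.1 hN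
  obtain ⟨p, hp, hpN, hpi⟩ : ∃ p ∈ Metric.ball (x + τ • e) (τ * κ), p ∉ N ∧
      -K * ‖x - p‖ ^ 2 ≤ ⟪v - b t p, x - p⟫ := by
    by_contra hcon
    push Not at hcon
    apply hpos
    rw [measure_eq_zero_iff_ae_notMem]
    filter_upwards [hNae, h] with p h1 h2 h3
    exact absurd h2 (not_le.2 (hcon p h3 h1))
  -- displacement
  set q := τ⁻¹ • (p - x) with hq
  have hpx : p - x = τ • q := by rw [hq, smul_smul, mul_inv_cancel₀ hτ0.ne', one_smul]
  have hqe : ‖q - e‖ < κ := by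
    rw [mem_ball_iff_norm] at hp
    have : p - (x + τ • e) = τ • (q - e) := by rw [smul_sub, ← hpx]; abel
    rw [this, norm_smul, Real.norm_of_nonneg hτ0.le] at hp
    exact lt_of_mul_lt_mul_left hp hτ0.le
  have hqA : ‖q‖ ≤ A := by
    have : q = e + (q - e) := by abel
    rw [this]; exact (norm_add_le _ _).trans (by rw [hA]; gcongr)
  have hpb : p ∈ Metric.ball x δ := by
    rw [mem_ball_iff_norm, hpx, norm_smul, Real.norm_of_nonneg hτ0.le]
    exact lt_of_le_of_lt (by gcongr) hτ1
  have hfb := hu1 _ (subset_closure (subset_convexHull ℝ _ ⟨p, ⟨hpb, hpN⟩, rfl⟩))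
  have h1 : c < ⟪v - b t p, e⟫ := by
    rw [real_inner_comm, inner_sub_right, ← hfe, ← hfe]; linarith
  have h2 : |⟪v - b t p, q - e⟫| ≤ R * κ := by
    refine (abs_real_inner_le_norm _ _).trans ?_
    have : ‖v - b t p‖ ≤ R := (norm_sub_le _ _).trans (by rw [hR]; gcongr; exact hb.bdd t p)
    gcongr
  have h3 : R * κ = c / 2 := by rw [hκ]; field_simp
  have h4 : ⟪v - b t p, q⟫ ≤ K * τ * A ^ 2 := by
    have e1 : x - p = -(τ • q) := by rw [← hpx]; abel
    rw [e1, inner_neg_right, inner_smul_right, norm_neg, norm_smul,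
      Real.norm_of_nonneg hτ0.le, mul_pow] at hpi
    have : τ * ⟪v - b t p, q⟫ ≤ τ * (K * τ * ‖q‖ ^ 2) := by nlinarith
    have := le_of_mul_le_mul_left this hτ0
    refine this.trans ?_
    gcongr
  have h5 : ⟪v - b t p, q⟫ = ⟪v - b t p, e⟫ + ⟪v - b t p, q - e⟫ := by
    rw [← inner_add_right]; congr 1; abel
  have := (abs_le.1 h2).1
  linarith

lemma f_meas {b : ℝ → V → V} {C : ℝ} (hb : GField b C) {T : ℝ} {u : ℝ → V} (p : V)
    (hu : ContinuousOn u (Icc 0 T)) {s t : ℝ} (hs : 0 ≤ s) (ht : t ≤ T) (e : ℝ) :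
    AEStronglyMeasurable (fun r => 2 * ⟪b r p, u r - p⟫ - 4 * C * ‖u r - p‖ ^ 2 - e)
      (volume.restrict (Ioc s t)) := by
  have h1 : AEStronglyMeasurable u (volume.restrict (Ioc s t)) :=
    (hu.mono (Ioc_subset_Icc_self.trans (Icc_subset_Icc hs ht))).aestronglyMeasurable
      measurableSet_Ioc
  have h2 : AEStronglyMeasurable (fun r => b r p) (volume.restrict (Ioc s t)) :=
    (hb.meas.comp (measurable_id.prodMk measurable_const)).aestronglyMeasurable
  have h3 : AEStronglyMeasurable (fun r => u r - p) (volume.restrict (Ioc s t)) :=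
    h1.sub aestronglyMeasurable_const
  exact (((h2.inner h3).const_mul 2).sub ((h3.norm.pow 2).const_mul (4 * C))).sub
    aestronglyMeasurable_const

lemma f_bdd {b : ℝ → V → V} {C : ℝ} (hb : GField b C) {r : ℝ} {x p : V} {M e : ℝ}
    (h : ‖x - p‖ ≤ M) (he : |e| ≤ 24 * C) :
    ‖2 * ⟪b r p, x - p⟫ - 4 * C * ‖x - p‖ ^ 2 - e‖ ≤ 2 * (C * M) + 4 * C * M ^ 2 + 24 * C := by
  have hC := hb.pos
  have h1 : |⟪b r p, x - p⟫| ≤ C * M := by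
    refine (abs_real_inner_le_norm _ _).trans ?_
    have := hb.bdd r p
    gcongr
  have h2 : ‖x - p‖ ^ 2 ≤ M ^ 2 := by gcongr
  have h3 : 4 * C * ‖x - p‖ ^ 2 ≤ 4 * C * M ^ 2 := by gcongr
  have h4 : 0 ≤ 4 * C * ‖x - p‖ ^ 2 := by positivity
  rw [Real.norm_eq_abs]
  rw [abs_le] at h1 he ⊢
  constructor <;> linarith [h1.1, h1.2, he.1, he.2]

lemma f_int {b : ℝ → V → V} {C : ℝ} (hb : GField b C) {T : ℝ} {u : ℝ → V} (p : V)
    (hu : ContinuousOn u (Icc 0 T)) {s t : ℝ} (hs : 0 ≤ s) (hst : s ≤ t) (ht : t ≤ T) {e M : ℝ}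
    (he : |e| ≤ 24 * C) (hM : ∀ r ∈ Icc 0 T, ‖u r - p‖ ≤ M) :
    IntervalIntegrable (fun r => 2 * ⟪b r p, u r - p⟫ - 4 * C * ‖u r - p‖ ^ 2 - e)
      volume s t := by
  rw [intervalIntegrable_iff_integrableOn_Ioc_of_le hst]
  refine IntegrableOn.of_bound (by simp) (f_meas hb p hu hs ht e)
    (2 * (C * M) + 4 * C * M ^ 2 + 24 * C) ?_
  rw [ae_restrict_iff' measurableSet_Ioc]
  refine Eventually.of_forall fun r hr => f_bdd hb (hM r ⟨hs.trans hr.1.le, hr.2.trans ht⟩) he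

lemma appr_ineq {b : ℝ → V → V} {C : ℝ} (hb : GField b C) {T η : ℝ} (h0 : 0 < η)
    (h1 : η ≤ 1) {γ : ℝ → V} (hγ : Appr b C T η γ) (p : V) {M : ℝ}
    (hM : ∀ r ∈ Icc 0 T, ‖γ r - p‖ ≤ M) {s t : ℝ} (hs : 0 ≤ s)
    (hst : s ≤ t) (ht : t ≤ T) :
    ∫ r in s..t, (2 * ⟪b r p, γ r - p⟫ - 4 * C * ‖γ r - p‖ ^ 2 - 24 * C * η) ≤
      ‖γ t - p‖ ^ 2 - ‖γ s - p‖ ^ 2 := by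
  have hC := hb.pos
  have hL : LipschitzOnWith (C.toNNReal + 0) (fun r => γ r - p) (uIcc s t) := by
    rw [uIcc_of_le hst]
    exact (hγ.1.mono (Icc_subset_Icc hs ht)).sub (LipschitzWith.const p).lipschitzOnWith
  refine ac_ge hst (ac_norm_sq hL) (f_int hb p hγ.1.continuousOn hs hst ht ?_ hM) ?_
  · rw [abs_of_nonneg (by positivity)]
    nlinarith
  · filter_upwards [hγ.2] with r hr hr'
    obtain ⟨v, d1, m1⟩ := hr ⟨hs.trans_lt hr'.1, hr'.2.trans ht⟩
    refine ⟨_, (d1.sub_const p).norm_sq, ?_⟩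
    have k := key_ineq hb h1 m1 (mem_hull (b := b) (t := r) (Metric.mem_ball_self (x := p) h0))
    rw [inner_sub_left] at k
    rw [real_inner_comm v]
    linarith

lemma limit_sol {b : ℝ → V → V} {C : ℝ} (hb : GField b C) {T : ℝ} (hT : 0 < T)
    {γn : ℕ → ℝ → V} {η : ℕ → ℝ} (h0 : ∀ n, 0 < η n) (h1 : ∀ n, η n ≤ 1)
    (hη : Tendsto η atTop (𝓝 0)) (hγn : ∀ n, Appr b C T (η n) (γn n)) {γ : ℝ → V}
    (hlim : ∀ t ∈ Icc 0 T, Tendsto (fun n => γn n t) atTop (𝓝 (γ t))) :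
    IsFilippovSolOn d b γ 0 T := by
  have hC := hb.pos
  have hLn : ∀ n, ∀ x ∈ Icc 0 T, ∀ y ∈ Icc 0 T, dist (γn n x) (γn n y) ≤ C * dist x y := by
    intro n x hx y hy
    have := (hγn n).1.dist_le_mul x hx y hy
    rwa [Real.coe_toNNReal _ hC.le] at this
  have hL : ∀ x ∈ Icc 0 T, ∀ y ∈ Icc 0 T, dist (γ x) (γ y) ≤ C * dist x y := by
    intro x hx y hy
    exact le_of_tendsto' ((hlim x hx).dist (hlim y hy)) fun n => hLn n x hx y hy
  set G : ℝ → V := fun t => γ (projIcc 0 T hT.le t) with hG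
  have hGeq : ∀ t ∈ Icc 0 T, G t = γ t := fun t ht => by
    simp only [hG, projIcc_of_mem hT.le ht]
  have hGL : LipschitzWith C.toNNReal G := by
    refine LipschitzWith.of_dist_le_mul fun x y => ?_
    rw [Real.coe_toNNReal _ hC.le]
    refine (hL _ (projIcc 0 T hT.le x).2 _ (projIcc 0 T hT.le y).2).trans ?_
    gcongr
    have := (LipschitzWith.projIcc hT.le).dist_le_mul x y
    simpa [Subtype.dist_eq] using this
  set g : ℝ → V := deriv G with hg
  have hgm : Measurable g := measurable_deriv G
  have hgb : ∀ t, ‖g t‖ ≤ C := fun t => by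
    have := norm_deriv_le_of_lipschitz (x₀ := t) hGL
    rwa [Real.coe_toNNReal _ hC.le] at this
  have hgi : ∀ s t, IntervalIntegrable g volume s t := fun s t => by
    rw [intervalIntegrable_iff]
    exact IntegrableOn.of_bound (by simp [uIoc]) hgm.aestronglyMeasurable C
      (Eventually.of_forall hgb)
  have hGd : ∀ᵐ t, HasDerivAt G (g t) t := by
    filter_upwards [hGL.ae_differentiableAt_real] with t ht
    exact ht.hasDerivAt
  -- FTC
  have hftc : ∀ t ∈ Icc 0 T, G t = G 0 + ∫ s in (0:ℝ)..t, g s := by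
    have hLI : LipschitzWith C.toNNReal (fun t => ∫ s in (0:ℝ)..t, g s) := by
      refine LipschitzWith.of_dist_le_mul fun x y => ?_
      rw [Real.coe_toNNReal _ hC.le, dist_eq_norm, Real.dist_eq,
        intervalIntegral.integral_interval_sub_left (hgi _ _) (hgi _ _)]
      exact intervalIntegral.norm_integral_le_of_norm_le_const fun s _ => hgb s
    have hac : AbsolutelyContinuousOnInterval (fun t => G t - ∫ s in (0:ℝ)..t, g s) 0 T :=
      (hGL.sub hLI).lipschitzOnWith.absolutelyContinuousOnInterval
    obtain ⟨k, hk⟩ := hac.const_of_ae_hasDerivAt_zero (by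
      filter_upwards [hGd, (hgi 0 T).ae_hasDerivAt_integral] with t a1 a2 ht
      have := a1.sub (a2 ht 0 (by simp))
      rwa [sub_self] at this)
    intro t ht
    have k1 := hk 0 (by simp)
    have k2 := hk t (by rwa [uIcc_of_le hT.le])
    simp only [intervalIntegral.integral_same, sub_zero] at k1
    rw [k1, ← k2]; abel
  -- limit inequality
  have hMex : ∀ p : V, ∃ M, (∀ n, ∀ r ∈ Icc 0 T, ‖γn n r - p‖ ≤ M) ∧
      ∀ r ∈ Icc 0 T, ‖G r - p‖ ≤ M := by
    intro p
    have h00 : (0:ℝ) ∈ Icc 0 T := ⟨le_rfl, hT.le⟩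
    obtain ⟨M, hM⟩ := ((hlim 0 h00).sub_const p).norm.bddAbove_range
    have a1 : ∀ n, ∀ r ∈ Icc 0 T, ‖γn n r - p‖ ≤ M + C * T := by
      intro n r hr
      have i1 : ‖γn n 0 - p‖ ≤ M := hM ⟨n, rfl⟩
      have i2 := hLn n r hr 0 h00
      rw [dist_eq_norm, Real.dist_eq, sub_zero, abs_of_nonneg hr.1] at i2
      have i3 : C * r ≤ C * T := by gcongr; exact hr.2
      have : γn n r - p = (γn n r - γn n 0) + (γn n 0 - p) := by abel
      rw [this]
      refine (norm_add_le _ _).trans (by linarith)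
    refine ⟨M + C * T, a1, fun r hr => ?_⟩
    rw [hGeq r hr]
    exact le_of_tendsto' ((hlim r hr).sub_const p).norm fun n => a1 n r hr
  have hineq : ∀ p : V, ∀ s t, 0 ≤ s → s ≤ t → t ≤ T →
      ∫ r in s..t, (2 * ⟪b r p, G r - p⟫ - 4 * C * ‖G r - p‖ ^ 2 - 0) ≤
      ‖G t - p‖ ^ 2 - ‖G s - p‖ ^ 2 := by
    intro p s t hs hst ht
    obtain ⟨M, hM, -⟩ := hMex p
    have e1 : ∀ n, |24 * C * η n| ≤ 24 * C := fun n => by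
      have := h0 n; have := h1 n
      rw [abs_of_nonneg (by positivity)]; nlinarith
    have hs' : s ∈ Icc 0 T := ⟨hs, hst.trans ht⟩
    have ht' : t ∈ Icc 0 T := ⟨hs.trans hst, ht⟩
    rw [hGeq s hs', hGeq t ht']
    have hD : Tendsto (fun n => ∫ r in s..t,
        (2 * ⟪b r p, γn n r - p⟫ - 4 * C * ‖γn n r - p‖ ^ 2 - 24 * C * η n)) atTop
        (𝓝 (∫ r in s..t, (2 * ⟪b r p, G r - p⟫ - 4 * C * ‖G r - p‖ ^ 2 - 0))) := by
      refine intervalIntegral.tendsto_integral_filter_of_dominated_convergence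
        (fun _ => 2 * (C * M) + 4 * C * M ^ 2 + 24 * C) ?_ ?_ intervalIntegrable_const ?_
      · refine Eventually.of_forall fun n => ?_
        rw [uIoc_of_le hst]
        exact f_meas hb p (hγn n).1.continuousOn hs ht _
      · refine Eventually.of_forall fun n => Eventually.of_forall fun r hr => ?_
        rw [uIoc_of_le hst] at hr
        exact f_bdd hb (hM n r ⟨hs.trans hr.1.le, hr.2.trans ht⟩) (e1 n)
      · refine Eventually.of_forall fun r hr => ?_
        rw [uIoc_of_le hst] at hr
        have hr' : r ∈ Icc 0 T := ⟨hs.trans hr.1.le, hr.2.trans ht⟩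
        rw [hGeq r hr']
        have l := (hlim r hr').sub_const p
        have l2 : Tendsto (fun n => 24 * C * η n) atTop (𝓝 0) := by
          simpa using hη.const_mul (24 * C)
        exact (((tendsto_const_nhds.inner l).const_mul 2).sub
          ((l.norm.pow 2).const_mul (4 * C))).sub l2
    exact le_of_tendsto_of_tendsto' hD
      ((((hlim t ht').sub_const p).norm.pow 2).sub (((hlim s hs').sub_const p).norm.pow 2))
      fun n => appr_ineq hb (h0 n) (h1 n) (hγn n) p (hM n) hs hst ht
  -- pointwise inequality
  have hpt : ∀ p : V, ∀ᵐ s, s ∈ Ioo 0 T →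
      -(2 * C) * ‖G s - p‖ ^ 2 ≤ ⟪g s - b s p, G s - p⟫ := by
    intro p
    obtain ⟨M, -, hM⟩ := hMex p
    have hGc := hGL.continuous.continuousOn (s := Icc 0 T)
    have e0 : |(0:ℝ)| ≤ 24 * C := by simp; positivity
    have hfi := f_int hb p hGc le_rfl hT.le le_rfl e0 hM
    filter_upwards [hGd, hfi.ae_hasDerivAt_integral] with s a1 a2 hs
    have D := ((a1.sub_const p).norm_sq).sub
      (a2 (by rw [uIcc_of_le hT.le]; exact Ioo_subset_Icc_self hs) 0 (by simp))
    have hmono : MonotoneOn ((fun t => ‖G t - p‖ ^ 2) - fun t => ∫ r in (0:ℝ)..t,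
        (2 * ⟪b r p, G r - p⟫ - 4 * C * ‖G r - p‖ ^ 2 - 0)) (Icc 0 T) := by
      intro x hx y hy hxy
      have i := hineq p x y hx.1 hxy hy.2
      have := intervalIntegral.integral_add_adjacent_intervals
        (f_int hb p hGc le_rfl hx.1 hx.2 e0 hM) (f_int hb p hGc hx.1 hxy hy.2 e0 hM)
      simp only [Pi.sub_apply]
      linarith
    have nn := hmono.derivWithin_nonneg (x := s)
    rw [derivWithin_of_mem_nhds (Icc_mem_nhds hs.1 hs.2), D.deriv] at nn
    rw [inner_sub_left, real_inner_comm _ (g s)]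
    linarith
  have hae : ∀ᵐ s : ℝ, ∀ᵐ p : V, s ∈ Ioo 0 T →
      -(2 * C) * ‖G s - p‖ ^ 2 ≤ ⟪g s - b s p, G s - p⟫ := by
    rw [Measure.ae_ae_comm (p := fun s p => s ∈ Ioo 0 T →
      -(2 * C) * ‖G s - p‖ ^ 2 ≤ ⟪g s - b s p, G s - p⟫)]
    · exact Eventually.of_forall hpt
    · have m1 : MeasurableSet {x : ℝ × V | x.1 ∈ Ioo 0 T} := measurable_fst measurableSet_Ioo
      have mG : Measurable fun x : ℝ × V => G x.1 - x.2 :=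
        (hGL.continuous.measurable.comp measurable_fst).sub measurable_snd
      have mb : Measurable fun x : ℝ × V => g x.1 - b x.1 x.2 :=
        (hgm.comp measurable_fst).sub hb.meas
      have m2 : MeasurableSet {x : ℝ × V | -(2 * C) * ‖G x.1 - x.2‖ ^ 2 ≤
          ⟪g x.1 - b x.1 x.2, G x.1 - x.2⟫} :=
        measurableSet_le ((mG.norm.pow_const 2).const_mul _) (mb.inner mG)
      exact m1.imp m2
  refine ⟨g, ?_, ?_, ?_⟩
  · have := hgi 0 T
    rwa [intervalIntegrable_iff_integrableOn_Ioc_of_le hT.le] at this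
  · rw [← restrict_Ioo_eq_restrict_Ioc, ae_restrict_iff' measurableSet_Ioo]
    filter_upwards [hae] with s hs hs'
    rw [← hGeq s (Ioo_subset_Icc_self hs')]
    refine mem_filippov hb (K := 2 * C) (by positivity) ?_
    filter_upwards [hs] with p hp
    exact hp hs'
  · intro t ht
    rw [← hGeq t ht, ← hGeq 0 ⟨le_rfl, hT.le⟩, hftc t ht, intervalIntegral.integral_of_le ht.1]

lemma mollify {b : ℝ → V → V} {C : ℝ} (hb : GField b C) {r : ℝ} (hr : 0 < r) :
    ∃ β : ℝ → V → V, Measurable (Function.uncurry β) ∧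
      (∃ L : ℝ, 0 ≤ L ∧ ∀ s x y, ‖β s x - β s y‖ ≤ L * ‖x - y‖) ∧ ∀ s x, β s x ∈ Hull b s x r := by
  have hC := hb.pos
  set ρ : V → ℝ := fun z => max 0 (r - ‖z‖) with hρ
  have hρc : Continuous ρ := by fun_prop
  have hρ0 : ∀ z, 0 ≤ ρ z := fun z => le_max_left _ _
  have hρs : ∀ z, z ∉ Metric.closedBall (0:V) r → ρ z = 0 := by
    intro z hz
    simp only [mem_closedBall_zero_iff, not_le] at hz
    simp only [hρ]; exact max_eq_left (by linarith)
  have hcs : HasCompactSupport ρ :=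
    HasCompactSupport.intro (isCompact_closedBall (0:V) r) hρs
  have hρi : Integrable ρ := hρc.integrable_of_hasCompactSupport hcs
  set c := ∫ z, ρ z with hc
  have hc0 : 0 < c := by
    refine hρc.integral_pos_of_hasCompactSupport_nonneg_nonzero hcs hρ0 (x := 0) ?_
    simp [hρ, hr.le, hr.ne']
  have hρix : ∀ x, Integrable (fun z => ρ (x - z)) := fun x => hρi.comp_sub_left x
  have hbs : ∀ s, Measurable (b s) := fun s => hb.meas.comp measurable_prodMk_left
  have hFi : ∀ s x, Integrable (fun z => ρ (x - z) • b s z) := fun s x => by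
    refine ((hρix x).mul_const C).mono'
      ((hρix x).aestronglyMeasurable.smul (hbs s).aestronglyMeasurable) ?_
    refine Eventually.of_forall fun z => ?_
    rw [norm_smul, Real.norm_of_nonneg (hρ0 _)]
    exact mul_le_mul_of_nonneg_left (hb.bdd s z) (hρ0 _)
  refine ⟨fun s x => c⁻¹ • ∫ z, ρ (x - z) • b s z, ?_, ?_, ?_⟩
  · have : StronglyMeasurable (fun q : (ℝ × V) × V => ρ (q.1.2 - q.2) • b q.1.1 q.2) := by
      apply Measurable.stronglyMeasurable
      refine Measurable.smul (hρc.measurable.comp (by fun_prop)) ?_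
      exact hb.meas.comp ((measurable_fst.comp measurable_fst).prodMk measurable_snd)
    exact (this.integral_prod_right (ν := (volume : Measure V))).measurable.const_smul c⁻¹
  · set m := volume.real (Metric.closedBall (0:V) r) with hm
    refine ⟨c⁻¹ * (C * (m + m)), by positivity, fun s x y => ?_⟩
    rw [← smul_sub, ← integral_sub (hFi s x) (hFi s y), norm_smul, norm_inv,
      Real.norm_of_nonneg hc0.le, mul_assoc]
    gcongr
    set S := Metric.closedBall x r ∪ Metric.closedBall y r with hS
    have hmem : ∀ x z : V, z ∉ Metric.closedBall x r → ρ (x - z) = 0 := by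
      intro x z hz
      apply hρs
      simpa [dist_eq_norm, norm_sub_rev] using hz
    rw [← setIntegral_eq_integral_of_forall_compl_eq_zero (s := S)]
    · have fin1 : ∀ x : V, volume (Metric.closedBall x r) < ⊤ := fun x => measure_closedBall_lt_top
      have hSf : volume S < ⊤ := measure_union_lt_top (fin1 x) (fin1 y)
      refine (norm_setIntegral_le_of_norm_le_const (C := ‖x - y‖ * C) hSf fun z _ => ?_).trans ?_
      · rw [← sub_smul, norm_smul]
        have : ‖ρ (x - z) - ρ (y - z)‖ ≤ ‖x - y‖ := by
          have h1 : |ρ (x - z) - ρ (y - z)| ≤ |(r - ‖x - z‖) - (r - ‖y - z‖)| := by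
            simp only [hρ]
            have := abs_max_sub_max_le_abs (r - ‖x - z‖) (r - ‖y - z‖) 0
            rwa [max_comm _ 0, max_comm _ 0] at this
          refine h1.trans ?_
          have h2 := abs_norm_sub_norm_le (y - z) (x - z)
          have e1 : (r - ‖x - z‖) - (r - ‖y - z‖) = ‖y - z‖ - ‖x - z‖ := by ring
          have e2 : y - z - (x - z) = -(x - y) := by abel
          rw [e2, norm_neg] at h2
          rwa [e1]
        exact mul_le_mul this (hb.bdd s z) (norm_nonneg _) (norm_nonneg _)
      · have hbx : ∀ x : V, volume.real (Metric.closedBall x r) = m := fun x => by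
          rw [hm, measureReal_def, measureReal_def, Measure.addHaar_closedBall_center]
        have : volume.real S ≤ m + m := by
          have := measureReal_union_le (μ := volume) (Metric.closedBall x r) (Metric.closedBall y r)
          rwa [hbx, hbx] at this
        calc ‖x - y‖ * C * volume.real S ≤ ‖x - y‖ * C * (m + m) := by gcongr
          _ = _ := by ring
    · intro z hz
      simp only [hS, mem_union, not_or] at hz
      rw [hmem x z hz.1, hmem y z hz.2]; simp
  · intro s x
    set w : V → ℝ≥0∞ := fun z => ENNReal.ofReal (c⁻¹ * ρ (x - z)) with hw
    have hwm : Measurable w := by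
      refine ENNReal.measurable_ofReal.comp ((hρc.measurable.comp (by fun_prop)).const_mul _)
    have hw0 : ∀ z, 0 ≤ c⁻¹ * ρ (x - z) := fun z => mul_nonneg (by positivity) (hρ0 _)
    have hprob : IsProbabilityMeasure (volume.withDensity w) := by
      constructor
      rw [withDensity_apply _ MeasurableSet.univ, setLIntegral_univ, hw,
        ← ofReal_integral_eq_lintegral_ofReal ((hρix x).const_mul _) (Eventually.of_forall hw0),
        integral_const_mul, integral_sub_left_eq_self ρ volume x, ← hc,
        inv_mul_cancel₀ hc0.ne', ENNReal.ofReal_one]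
    have hrep : c⁻¹ • ∫ z, ρ (x - z) • b s z = ∫ z, b s z ∂(volume.withDensity w) := by
      rw [integral_withDensity_eq_integral_toReal_smul hwm (by simp [hw]), ← integral_smul]
      congr 1; ext1 z
      rw [hw, ENNReal.toReal_ofReal (hw0 z), smul_smul]
    simp only [hrep]
    refine (hull_convex b s x r).integral_mem (hull_closed b s x r) ?_ ?_
    · rw [ae_withDensity_iff hwm]
      refine Eventually.of_forall fun z hz => mem_hull ?_
      by_contra hcon
      apply hz
      have : ρ (x - z) = 0 := by
        simp only [Metric.mem_ball, not_lt, dist_eq_norm] at hcon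
        rw [norm_sub_rev] at hcon
        simp only [hρ]; exact max_eq_left (by linarith)
      simp [hw, this]
    · exact Integrable.of_bound (hbs s).aestronglyMeasurable C (Eventually.of_forall (hb.bdd s))

lemma step_surj {u : V → V} {K : ℝ} (hK0 : 0 ≤ K) (hK : K < 1)
    (hu : ∀ x y, ‖u x - u y‖ ≤ K * ‖x - y‖) :
    Continuous (fun x => x + u x) ∧ Function.Surjective (fun x => x + u x) := by
  have hL : LipschitzWith ⟨K, hK0⟩ u := LipschitzWith.of_dist_le_mul fun x y => by
    rw [dist_eq_norm, dist_eq_norm]; exact hu x y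
  refine ⟨continuous_id.add hL.continuous, fun y => ?_⟩
  have hc : ContractingWith ⟨K, hK0⟩ (fun x => y - u x) := by
    refine ⟨by exact_mod_cast hK, LipschitzWith.of_dist_le_mul fun a c => ?_⟩
    have : (y - u a) - (y - u c) = -(u a - u c) := by abel
    rw [dist_eq_norm, this, norm_neg, dist_eq_norm]
    exact hu a c
  refine ⟨hc.fixedPoint, ?_⟩
  have := hc.fixedPoint_isFixedPt
  have h2 : y - u hc.fixedPoint = hc.fixedPoint := this
  show hc.fixedPoint + u hc.fixedPoint = y
  exact (eq_add_of_sub_eq h2).symm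

lemma approx_exists {b : ℝ → V → V} {C : ℝ} (hb : GField b C) {T : ℝ} (hT : 0 < T) {η : ℝ}
    (hη : 0 < η) : ∃ Φ : V → V, Continuous Φ ∧ Function.Surjective Φ ∧
      ∀ x, ∃ γ, Appr b C T η γ ∧ γ 0 = x ∧ γ T = Φ x := by
  have hC := hb.pos
  obtain ⟨β, hβm, ⟨L, hL0, hβL⟩, hβH⟩ := mollify hb (half_pos hη)
  have hβC : ∀ s x, ‖β s x‖ ≤ C := fun s x => hull_bdd hb (hβH s x)
  obtain ⟨n, hn⟩ := exists_nat_gt (max (L * T) (2 * C * T / η))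
  have hn1 : L * T < n := (le_max_left _ _).trans_lt hn
  have hn2 : 2 * C * T / η < n := (le_max_right _ _).trans_lt hn
  have hn0 : (0:ℝ) < n := lt_of_le_of_lt (by positivity) hn1
  set h := T / n with hh
  have h0 : 0 < h := by positivity
  have hLh : L * h < 1 := by
    rw [hh, ← mul_div_assoc, div_lt_one hn0]; exact hn1
  have hCh : C * h < η / 2 := by
    rw [hh, ← mul_div_assoc, div_lt_iff₀ hn0]
    rw [div_lt_iff₀ hη] at hn2; linarith
  have hnh : n * h = T := by rw [hh]; field_simp
  have hβsm : ∀ x, Measurable fun s => β s x := fun x =>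
    hβm.comp (measurable_id.prodMk measurable_const)
  have hβi : ∀ x a c, IntervalIntegrable (fun s => β s x) volume a c := fun x a c => by
    rw [intervalIntegrable_iff]
    exact IntegrableOn.of_bound (by simp [uIoc]) (hβsm x).aestronglyMeasurable C
      (Eventually.of_forall fun s => hβC s x)
  set F : ℕ → V → V := fun k x => x + ∫ s in ((k:ℝ) * h)..((k + 1 : ℕ) : ℝ) * h, β s x with hF
  have hlen : ∀ k : ℕ, ((k + 1 : ℕ) : ℝ) * h - k * h = h := fun k => by push_cast; ring
  have hFcs : ∀ k, Continuous (F k) ∧ Function.Surjective (F k) := by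
    intro k
    refine step_surj (K := L * h) (by positivity) hLh fun x y => ?_
    rw [← intervalIntegral.integral_sub (hβi _ _ _) (hβi _ _ _)]
    have := intervalIntegral.norm_integral_le_of_norm_le_const (a := (k:ℝ) * h)
      (b := ((k + 1 : ℕ) : ℝ) * h) (f := fun s => β s x - β s y) (C := L * ‖x - y‖)
      fun s _ => hβL s x y
    rw [hlen, abs_of_pos h0] at this
    linarith
  set X : ℕ → V → V := fun k => Nat.rec id (fun k Xk => F k ∘ Xk) k with hX
  have hX0 : ∀ x, X 0 x = x := fun x => rfl
  have hXs : ∀ k x, X (k + 1) x = F k (X k x) := fun k x => rfl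
  have hXcs : ∀ k, Continuous (X k) ∧ Function.Surjective (X k) := by
    intro k
    induction k with
    | zero => exact ⟨continuous_id, Function.surjective_id⟩
    | succ k ih => exact ⟨(hFcs k).1.comp ih.1, (hFcs k).2.comp ih.2⟩
  refine ⟨X n, (hXcs n).1, (hXcs n).2, fun x => ?_⟩
  set N : ℝ → ℕ := fun s => ⌈s / h⌉₊ - 1 with hN
  have hNm : Measurable N := by
    have : Measurable fun s : ℝ => ⌈s / h⌉₊ := Nat.measurable_ceil.comp (measurable_id.div_const h)
    exact (measurable_from_top (f := fun k : ℕ => k - 1)).comp this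
  set g : ℝ → V := fun s => β s (X (N s) x) with hg
  have hgm : Measurable g := by
    refine hβm.comp (measurable_id.prodMk ?_)
    exact (measurable_from_top (f := fun k : ℕ => X k x)).comp hNm
  have hgb : ∀ s, ‖g s‖ ≤ C := fun s => hβC _ _
  have hgi : ∀ a c, IntervalIntegrable g volume a c := fun a c => by
    rw [intervalIntegrable_iff]
    exact IntegrableOn.of_bound (by simp [uIoc]) hgm.aestronglyMeasurable C
      (Eventually.of_forall hgb)
  have hNk : ∀ (k : ℕ) (s : ℝ), s ∈ Ioc ((k:ℝ) * h) (((k + 1 : ℕ) : ℝ) * h) → N s = k := by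
    intro k s hs
    have : ⌈s / h⌉₊ = k + 1 := by
      rw [Nat.ceil_eq_iff (by omega)]
      constructor
      · rw [lt_div_iff₀ h0]; simpa using hs.1
      · rw [div_le_iff₀ h0]; exact hs.2
    simp [hN, this]
  set γ : ℝ → V := fun t => x + ∫ s in (0:ℝ)..t, g s with hγ
  have hγ0 : γ 0 = x := by simp [hγ]
  have hdiff : ∀ a c, γ c = γ a + ∫ s in a..c, g s := by
    intro a c
    simp only [hγ]
    rw [add_assoc, intervalIntegral.integral_add_adjacent_intervals (hgi _ _) (hgi _ _)]
  have hγk : ∀ k : ℕ, γ (k * h) = X k x := by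
    intro k
    induction k with
    | zero => simp [hγ0, hX0]
    | succ k ih =>
      rw [hdiff (k * h), ih, hXs]
      simp only [hF]
      congr 1
      apply intervalIntegral.integral_congr_ae
      refine Eventually.of_forall fun s hs => ?_
      rw [uIoc_of_le (by push_cast; nlinarith)] at hs
      simp only [hg, hNk k s hs]
  refine ⟨γ, ?_, hγ0, by rw [← hγk n, hnh]⟩
  refine appr_of_integral hb hT (g := g) ?_ ?_ ?_
  · have := hgi 0 T
    rwa [intervalIntegrable_iff_integrableOn_Ioc_of_le hT.le] at this
  · rw [ae_restrict_iff' measurableSet_Ioc]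
    refine Eventually.of_forall fun s hs => ?_
    obtain ⟨k, hk⟩ : ∃ k : ℕ, ⌈s / h⌉₊ = k + 1 :=
      Nat.exists_eq_succ_of_ne_zero (Nat.ceil_pos.2 (div_pos hs.1 h0)).ne'
    have hsk : s ∈ Ioc ((k:ℝ) * h) (((k + 1 : ℕ) : ℝ) * h) := by
      rw [Nat.ceil_eq_iff (by omega)] at hk
      rw [lt_div_iff₀ h0, div_le_iff₀ h0] at hk
      simpa using hk
    have hgs : g s = β s (X k x) := by simp only [hg, hNk k s hsk]
    rw [hgs]
    refine hull_mono ?_ (hβH s (X k x))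
    apply Metric.ball_subset_ball'
    rw [← hγk k, hdiff (k * h) s, dist_eq_norm]
    have e : γ (k * h) - (γ (k * h) + ∫ s in (k * h)..s, g s) = - ∫ s in (k * h)..s, g s := by abel
    rw [e, norm_neg]
    have := intervalIntegral.norm_integral_le_of_norm_le_const (a := (k:ℝ) * h)
      (b := s) (f := g) (C := C) fun s _ => hgb s
    have h2 : |s - k * h| ≤ h := by
      rw [abs_of_pos (by linarith [hsk.1])]
      have := hsk.2; have := hlen k; linarith
    have : C * |s - k * h| ≤ C * h := by gcongr
    linarith
  · intro t ht
    rw [hγ0, ← intervalIntegral.integral_of_le ht.1]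

lemma null_image {φ : V → V} {K : ℝ≥0} (hφ : LipschitzWith K φ) :
    volume {x | ∀ y, φ y = x → DifferentiableAt ℝ φ y ∧ (fderiv ℝ φ y).det ≠ 0}ᶜ = 0 := by
  have h1 : volume (φ '' {y | ¬ DifferentiableAt ℝ φ y}) = 0 := by
    have hN : volume {y | ¬ DifferentiableAt ℝ φ y} = 0 := hφ.ae_differentiableAt
    have hac : (μH[Module.finrank ℝ V] : Measure V) ≪ volume :=
      Measure.absolutelyContinuous_isAddHaarMeasure _ _
    have hac' : volume ≪ (μH[Module.finrank ℝ V] : Measure V) :=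
      Measure.absolutelyContinuous_isAddHaarMeasure _ _
    apply hac'
    have := hφ.hausdorffMeasure_image_le (d := Module.finrank ℝ V) (by positivity)
      {y | ¬ DifferentiableAt ℝ φ y}
    rw [hac hN, mul_zero] at this
    exact le_antisymm this zero_le
  have h2 : volume (φ '' {y | DifferentiableAt ℝ φ y ∧ (fderiv ℝ φ y).det = 0}) = 0 :=
    addHaar_image_eq_zero_of_det_fderivWithin_eq_zero volume (f' := fderiv ℝ φ)
      (fun y hy => hy.1.hasFDerivAt.hasFDerivWithinAt) fun y hy => hy.2
  refine measure_mono_null ?_ (measure_union_null h1 h2)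
  intro x hx
  simp only [mem_compl_iff, mem_ofPred_eq, not_forall] at hx
  obtain ⟨y, hy, hn⟩ := hx
  by_cases hd : DifferentiableAt ℝ φ y
  · right
    refine ⟨y, ⟨hd, ?_⟩, hy⟩
    by_contra h; exact hn ⟨hd, h⟩
  · left; exact ⟨y, hd, hy⟩

lemma unique_preimage {φ : V → V} (hφ : Continuous φ) {Φ : ℕ → V → V} (hΦ : ∀ n, Continuous (Φ n))
    (hs : ∀ n, Function.Surjective (Φ n)) {s : ℕ → ℝ} (hs0 : Tendsto s atTop (𝓝 0))
    (hd : ∀ n w, ‖w - φ (Φ n w)‖ ≤ s n) {x y y' : V} (hy : φ y = x) (hy' : φ y' = x)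
    (hiso : ∀ᶠ z in 𝓝[≠] y, φ z ≠ x) : y' = y := by
  by_contra hne
  have hpos : 0 < dist y' y := dist_pos.2 hne
  rw [eventually_nhdsWithin_iff, Metric.eventually_nhds_iff] at hiso
  obtain ⟨ε, hε, hiso⟩ := hiso
  set ρ := min (ε / 2) (dist y' y) with hρ
  have hρ0 : 0 < ρ := by positivity
  have hz : ∀ n, ∃ z ∈ Metric.sphere y ρ, ‖φ z - x‖ ≤ 2 * s n := by
    intro n
    have hpc : IsPreconnected (Φ n '' Metric.closedBall x (s n)) :=
      (convex_closedBall x (s n)).isPreconnected.image _ (hΦ n).continuousOn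
    have hin : ∀ q, φ q = x → q ∈ Φ n '' Metric.closedBall x (s n) := by
      intro q hq
      obtain ⟨w, hw⟩ := hs n q
      refine ⟨w, ?_, hw⟩
      have := hd n w
      rw [hw, hq] at this
      rwa [mem_closedBall_iff_norm]
    have iv := hpc.intermediate_value (hin y hy) (hin y' hy') (f := fun z => dist z y)
      (by fun_prop)
    obtain ⟨z, ⟨w, hw, rfl⟩, hz⟩ := iv (show ρ ∈ Icc _ _ from
      ⟨by simpa using hρ0.le, min_le_right _ _⟩)
    refine ⟨Φ n w, hz, ?_⟩
    have h1 := hd n w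
    rw [mem_closedBall_iff_norm] at hw
    have : φ (Φ n w) - x = -(w - φ (Φ n w)) + (w - x) := by abel
    rw [this]
    refine (norm_add_le _ _).trans ?_
    rw [norm_neg]; linarith
  choose z hz1 hz2 using hz
  obtain ⟨a, ha, k, hk, hlim⟩ := (isCompact_sphere y ρ).tendsto_subseq hz1
  have l1 : Tendsto (fun n => φ (z (k n)) - x) atTop (𝓝 0) := by
    refine squeeze_zero_norm (fun n => hz2 (k n)) ?_
    simpa using (hs0.comp hk.tendsto_atTop).const_mul 2
  have l2 : Tendsto (fun n => φ (z (k n)) - x) atTop (𝓝 (φ a - x)) :=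
    ((hφ.tendsto a).comp hlim).sub_const x
  have e : φ a = x := sub_eq_zero.1 (tendsto_nhds_unique l2 l1)
  have had : dist a y = ρ := ha
  refine hiso (y := a) ?_ ?_ e
  · rw [had]; exact (min_le_left _ _).trans_lt (by linarith)
  · intro h
    have : a = y := h
    rw [this, dist_self] at had
    linarith

lemma core {b : ℝ → V → V} {C : ℝ} (hb : GField b C) {T : ℝ} (hT : 0 < T) :
    ∃ E : Set V, volume Eᶜ = 0 ∧ ∀ x ∈ E,
      ∃ γ : ℝ → V, IsFilippovSolOn d b γ 0 T ∧ γ 0 = x ∧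
        ∀ γ' : ℝ → V, IsFilippovSolOn d b γ' 0 T → γ' 0 = x →
          ∀ t ∈ Icc (0:ℝ) T, γ' t = γ t := by
  have hC := hb.pos
  set η : ℕ → ℝ := fun n => 1 / ((n:ℝ) + 1) with hη
  have η0 : ∀ n, 0 < η n := fun n => by positivity
  have η1 : ∀ n, η n ≤ 1 := fun n => by
    simp only [hη]; rw [div_le_one (by positivity)]; linarith [(n.cast_nonneg : (0:ℝ) ≤ n)]
  have ηlim : Tendsto η atTop (𝓝 0) := tendsto_one_div_add_atTop_nhds_zero_nat
  have ηanti : ∀ {m n}, m ≤ n → η n ≤ η m := fun {m n} h => Nat.one_div_le_one_div h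
  have h0T : (0:ℝ) ∈ Icc 0 T := ⟨le_rfl, hT.le⟩
  have hTT : T ∈ Icc 0 T := ⟨hT.le, le_rfl⟩
  set A := Real.exp (4 * C * T) with hA
  have hA0 : 0 < A := Real.exp_pos _
  set s : ℕ → ℝ := fun n => √(A * (24 * C * T * η n)) with hs
  have hslim : Tendsto s atTop (𝓝 0) := by
    have : Tendsto (fun n => A * (24 * C * T * η n)) atTop (𝓝 0) := by
      simpa using (ηlim.const_mul (24 * C * T)).const_mul A
    simpa using this.sqrt
  have stab : ∀ n (γ γ' : ℝ → V), Appr b C T (η n) γ → Appr b C T (η n) γ' → γ T = γ' T →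
      ∀ t ∈ Icc 0 T, ‖γ t - γ' t‖ ≤ s n := by
    intro n γ γ' h h' he t ht
    have := stability hb (η0 n) (η1 n) h h' t ht
    rw [he, sub_self, norm_zero] at this
    apply Real.le_sqrt_of_sq_le
    simpa using this
  choose Φ hΦc hΦs hΦ using fun n => approx_exists hb hT (η0 n)
  -- approximate backward solutions
  have hback : ∀ (y : V) (n : ℕ), ∃ γ, Appr b C T (η n) γ ∧ γ T = y := by
    intro y n
    obtain ⟨x, hx⟩ := hΦs n y
    obtain ⟨γ, h1, -, h3⟩ := hΦ n x
    exact ⟨γ, h1, h3.trans hx⟩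
  have hsol : ∀ y : V, ∃ γ, IsFilippovSolOn d b γ 0 T ∧ γ T = y := by
    intro y
    choose γn hγn hγT using hback y
    have hcau : ∀ t ∈ Icc 0 T, ∃ l, Tendsto (fun n => γn n t) atTop (𝓝 l) := by
      intro t ht
      apply cauchySeq_tendsto_of_complete
      refine cauchySeq_of_le_tendsto_0 s (fun n m N hn hm => ?_) hslim
      rw [dist_eq_norm]
      exact stab N _ _ ((hγn n).mono (ηanti hn)) ((hγn m).mono (ηanti hm))
        ((hγT n).trans (hγT m).symm) t ht
    choose! γ hγ using hcau
    refine ⟨γ, limit_sol hb hT η0 η1 ηlim hγn hγ, ?_⟩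
    refine tendsto_nhds_unique (hγ T hTT) ?_
    simp [hγT]
  choose Γ hΓ hΓT using hsol
  set φ : V → V := fun y => Γ y 0 with hφ
  -- exact stability
  have exstab : ∀ γ γ' : ℝ → V, IsFilippovSolOn d b γ 0 T → IsFilippovSolOn d b γ' 0 T →
      ∀ t ∈ Icc 0 T, ‖γ t - γ' t‖ ^ 2 ≤ A * ‖γ T - γ' T‖ ^ 2 := by
    intro γ γ' h h' t ht
    have l : Tendsto (fun n => A * (‖γ T - γ' T‖ ^ 2 + 24 * C * T * η n)) atTop
        (𝓝 (A * (‖γ T - γ' T‖ ^ 2 + 24 * C * T * 0))) :=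
      ((ηlim.const_mul (24 * C * T)).const_add _).const_mul A
    rw [mul_zero, add_zero] at l
    exact ge_of_tendsto' l fun n => stability hb (η0 n) (η1 n)
      (appr_of_sol hb hT (η0 n) h) (appr_of_sol hb hT (η0 n) h') t ht
  have hφL : LipschitzWith (√A).toNNReal φ := by
    refine LipschitzWith.of_dist_le_mul fun y y' => ?_
    rw [Real.coe_toNNReal _ (Real.sqrt_nonneg _), dist_eq_norm, dist_eq_norm]
    have := exstab _ _ (hΓ y) (hΓ y') 0 h0T
    rw [hΓT, hΓT] at this
    have := Real.le_sqrt_of_sq_le this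
    rwa [Real.sqrt_mul hA0.le, Real.sqrt_sq (norm_nonneg _)] at this
  have hd : ∀ n w, ‖w - φ (Φ n w)‖ ≤ s n := by
    intro n w
    obtain ⟨γ, h1, h2, h3⟩ := hΦ n w
    have := stab n γ (Γ (Φ n w)) h1 (appr_of_sol hb hT (η0 n) (hΓ _)) (by rw [h3, hΓT]) 0 h0T
    rwa [h2] at this
  have hsurj : Function.Surjective φ := by
    intro x
    have hin : ∀ n, Φ n x ∈ Metric.closedBall x (C * T) := by
      intro n
      obtain ⟨γ, h1, h2, h3⟩ := hΦ n x
      have := h1.1.dist_le_mul T hTT 0 h0T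
      rwa [h2, h3, Real.coe_toNNReal _ hC.le, Real.dist_eq, sub_zero, abs_of_pos hT] at this
    obtain ⟨a, -, k, hk, hlim⟩ := (isCompact_closedBall x (C * T)).tendsto_subseq hin
    refine ⟨a, ?_⟩
    have l1 : Tendsto (fun n => x - φ (Φ (k n) x)) atTop (𝓝 0) :=
      squeeze_zero_norm (fun n => hd (k n) x) (hslim.comp hk.tendsto_atTop)
    have l2 : Tendsto (fun n => x - φ (Φ (k n) x)) atTop (𝓝 (x - φ a)) :=
      ((hφL.continuous.tendsto a).comp hlim).const_sub x
    exact (sub_eq_zero.1 (tendsto_nhds_unique l2 l1)).symm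
  refine ⟨_, null_image hφL, fun x hx => ?_⟩
  obtain ⟨y, hy⟩ := hsurj x
  refine ⟨Γ y, hΓ y, hy, fun γ' h' h0' t ht => ?_⟩
  obtain ⟨hdy, hdet⟩ := hx y hy
  have hiso : ∀ᶠ z in 𝓝[≠] y, φ z ≠ x := by
    refine hdy.hasFDerivAt.eventually_ne ?_
    have := ((fderiv ℝ φ y).toContinuousLinearEquivOfDetNeZero hdet).antilipschitz
    exact ⟨_, this⟩
  have hback0 : φ (γ' T) = x := by
    have := exstab _ _ h' (hΓ (γ' T)) 0 h0T
    rw [hΓT, sub_self, norm_zero, h0'] at this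
    have h2 : ‖x - φ (γ' T)‖ ^ 2 ≤ 0 := by simpa using this
    have h3 : ‖x - φ (γ' T)‖ = 0 := by
      apply pow_eq_zero_iff (two_ne_zero) |>.1
      exact le_antisymm h2 (sq_nonneg _)
    exact (sub_eq_zero.1 (norm_eq_zero.1 h3)).symm
  have heq : γ' T = y := unique_preimage hφL.continuous hΦc hΦs hslim hd hy hback0 hiso
  have := exstab _ _ h' (hΓ y) t ht
  rw [hΓT, heq, sub_self, norm_zero] at this
  have h2 : ‖γ' t - Γ y t‖ ^ 2 ≤ 0 := by simpa using this
  have h3 : ‖γ' t - Γ y t‖ = 0 := by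
    apply pow_eq_zero_iff (two_ne_zero) |>.1
    exact le_antisymm h2 (sq_nonneg _)
  exact sub_eq_zero.1 (norm_eq_zero.1 h3)

end helpers

/-- Lemma A.4 / `lem.kensf`: if `b` is a bounded Borel vector field
satisfying the half-Lipschitz condition from below, then there is a set `E ⊆ ℝ^d` of full
Lebesgue measure such that for every `x ∈ E` there exists a unique forward (maximal)
absolutely continuous solution of the Filippov inclusion `ẋ_t ∈ b^F_t(x_t)` on `[0,T]`
with `x_0 = x`. -/
theorem forward_filippov_ae_unique
    (T : ℝ) (hT : 0 < T) (b : ℝ → V → V) (C₀ : ℝ)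
    (hb : HalfLipschitzField d T b C₀) :
    ∃ E : Set V, volume Eᶜ = 0 ∧ ∀ x ∈ E,
      ∃ γ : ℝ → V, IsFilippovSolOn d b γ 0 T ∧ γ 0 = x ∧
        ∀ γ' : ℝ → V, IsFilippovSolOn d b γ' 0 T → γ' 0 = x →
          ∀ t ∈ Icc (0:ℝ) T, γ' t = γ t := by
  classical
  set b' : ℝ → V → V := fun t x => if t ∈ Icc (0:ℝ) T then b t x else 0 with hb'
  have hin : ∀ t ∈ Icc (0:ℝ) T, b' t = b t := fun t ht => by ext1 x; simp only [hb', if_pos ht]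
  have hout : ∀ t, t ∉ Icc (0:ℝ) T → ∀ x, b' t x = 0 := fun t ht x => by
    simp only [hb', if_neg ht]
  have hG : GField b' C₀ := by
    refine ⟨hb.pos, ?_, ?_, ?_⟩
    · exact Measurable.ite (measurable_fst measurableSet_Icc) hb.meas measurable_const
    · intro t x
      by_cases ht : t ∈ Icc (0:ℝ) T
      · rw [hin t ht]; exact hb.bdd t ht x
      · rw [hout t ht, norm_zero]; exact hb.pos.le
    · intro t x y
      by_cases ht : t ∈ Icc (0:ℝ) T
      · rw [hin t ht]; exact hb.halfLip t ht x y
      · rw [hout t ht, hout t ht, sub_self, inner_zero_left]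
        have := hb.pos
        have : 0 ≤ C₀ * ‖x - y‖ ^ 2 := by positivity
        linarith
  have hfil : ∀ t ∈ Ioc (0:ℝ) T, ∀ x, filippov d b' t x = filippov d b t x := by
    intro t ht x
    simp only [filippov, hin t (Ioc_subset_Icc_self ht)]
  have hiff : ∀ γ : ℝ → V, IsFilippovSolOn d b' γ 0 T ↔ IsFilippovSolOn d b γ 0 T := by
    intro γ
    have : ∀ g : ℝ → V, (∀ᵐ s ∂(volume.restrict (Ioc 0 T)), g s ∈ filippov d b' s (γ s)) ↔
        (∀ᵐ s ∂(volume.restrict (Ioc 0 T)), g s ∈ filippov d b s (γ s)) := by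
      intro g
      rw [ae_restrict_iff' measurableSet_Ioc, ae_restrict_iff' measurableSet_Ioc]
      refine eventually_congr (Eventually.of_forall fun s => ?_)
      exact forall_congr' fun hs => by rw [hfil s hs]
    simp only [IsFilippovSolOn, this]
  obtain ⟨E, hE, h⟩ := core hG hT
  refine ⟨E, hE, fun x hx => ?_⟩
  obtain ⟨γ, h1, h2, h3⟩ := h x hx
  exact ⟨γ, (hiff γ).1 h1, h2, fun γ' h' => h3 γ' ((hiff γ').2 h')⟩
end
end
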